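/- arXiv:2503.04975 — 9 statements merged into one kernel-verified Lean document; each statement's English description precedes it below -/
import Mathlib

section
/- For every t ∈ [0,1], the normalizing constant of the energy-tilted marginal is independent of t: ∫_{ℝ^d} p_t(x)·exp(−ℰ_t(x)) dx = ∫_{ℝ^d} p_0(x0)·exp(−β ℰ(x0)) dx0 = Z. -/
open MeasureTheory Set

/-- For every `t ∈ [0,1]`, the normalizing constant of the energy-tilted
marginal is independent of `t`:
`∫ p_t(x) · exp(−ℰ_t(x)) dx = ∫ p_0(x0) · exp(−β ℰ(x0)) dx0 = Z`. -/
theorem energy_tilted_normalizing_constant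
    (d : ℕ) (hd : 1 ≤ d)
    (p0 : EuclideanSpace ℝ (Fin d) → ℝ)
    (En : EuclideanSpace ℝ (Fin d) → ℝ)
    (β : ℝ) (hβ : 0 < β)
    (pt0 : ℝ → EuclideanSpace ℝ (Fin d) → EuclideanSpace ℝ (Fin d) → ℝ)
    -- `p0` is a probability density
    (hp0_nonneg : ∀ x, 0 ≤ p0 x)
    (hp0_meas : Measurable p0)
    (hp0_int : ∫ x, p0 x = 1)
    -- `ℰ` is measurable
    (hEn_meas : Measurable En)
    -- for each `t ∈ [0,1]` and `x0`, `pt0 t x0 · : x ↦ p_{t0}(x | x0)` is a probability density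
    (hpt0_nonneg : ∀ t ∈ Icc (0:ℝ) 1, ∀ x0 x, 0 ≤ pt0 t x0 x)
    (hpt0_meas : ∀ t ∈ Icc (0:ℝ) 1,
      Measurable (fun q : EuclideanSpace ℝ (Fin d) × EuclideanSpace ℝ (Fin d) => pt0 t q.1 q.2))
    (hpt0_int : ∀ t ∈ Icc (0:ℝ) 1, ∀ x0, ∫ x, pt0 t x0 x = 1)
    -- the normalizing constant `Z`, finite and positive
    (Z : ℝ)
    (hZ_def : Z = ∫ x0, p0 x0 * Real.exp (-β * En x0))
    (hZ_int : Integrable (fun x0 => p0 x0 * Real.exp (-β * En x0)))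
    (hZ_pos : 0 < Z)
    -- the marginal `p_t`, assumed positive
    (pt : ℝ → EuclideanSpace ℝ (Fin d) → ℝ)
    (hpt_def : ∀ t x, pt t x = ∫ x0, pt0 t x0 x * p0 x0)
    (hpt_pos : ∀ t ∈ Icc (0:ℝ) 1, ∀ x, 0 < pt t x)
    -- the posterior `p_{0t}(x0 | x)`
    (p0t : ℝ → EuclideanSpace ℝ (Fin d) → EuclideanSpace ℝ (Fin d) → ℝ)
    (hp0t_def : ∀ t x0 x, p0t t x0 x = pt0 t x0 x * p0 x0 / pt t x)
    -- the intermediate energy `ℰ_t`, with `exp (−ℰ_t x)` finite and positive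
    (Et : ℝ → EuclideanSpace ℝ (Fin d) → ℝ)
    (hEt_def : ∀ t ∈ Icc (0:ℝ) 1, ∀ x,
      Real.exp (-(Et t x)) = ∫ x0, p0t t x0 x * Real.exp (-β * En x0))
    (hEt_int : ∀ t ∈ Icc (0:ℝ) 1, ∀ x,
      Integrable (fun x0 => p0t t x0 x * Real.exp (-β * En x0))) :
    ∀ t ∈ Icc (0:ℝ) 1, ∫ x, pt t x * Real.exp (-(Et t x)) = Z := by
  intro t ht
  have h1 : ∀ x, pt t x * Real.exp (-(Et t x))
      = ∫ x0, pt0 t x0 x * (p0 x0 * Real.exp (-β * En x0)) := by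
    intro x
    have hne : pt t x ≠ 0 := (hpt_pos t ht x).ne'
    rw [hEt_def t ht x, ← integral_const_mul]
    congr 1
    funext x0
    rw [hp0t_def]
    field_simp
  have hslice : ∀ x0, Integrable (fun x => pt0 t x0 x) := by
    intro x0
    apply Integrable.of_integral_ne_zero
    rw [hpt0_int t ht x0]
    exact one_ne_zero
  have hm := hpt0_meas t ht
  have hint : Integrable (fun q : EuclideanSpace ℝ (Fin d) × EuclideanSpace ℝ (Fin d) =>
      pt0 t q.1 q.2 * (p0 q.1 * Real.exp (-β * En q.1))) (volume.prod volume) := by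
    rw [integrable_prod_iff (by
      apply Measurable.aestronglyMeasurable
      fun_prop)]
    refine ⟨Filter.Eventually.of_forall fun x0 => (hslice x0).mul_const (p0 x0 * Real.exp (-β * En x0)), ?_⟩
    refine hZ_int.congr (Filter.Eventually.of_forall fun x0 => ?_)
    have hw : 0 ≤ p0 x0 * Real.exp (-β * En x0) :=
      mul_nonneg (hp0_nonneg x0) (Real.exp_pos _).le
    have h2 : ∀ x, ‖pt0 t x0 x * (p0 x0 * Real.exp (-β * En x0))‖
        = pt0 t x0 x * (p0 x0 * Real.exp (-β * En x0)) := fun x =>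
      Real.norm_of_nonneg (mul_nonneg (hpt0_nonneg t ht x0 x) hw)
    simp only [h2]
    rw [integral_mul_const, hpt0_int t ht x0, one_mul]
  simp only [h1]
  rw [← integral_integral_swap
    (f := fun x0 x => pt0 t x0 x * (p0 x0 * Real.exp (-β * En x0))) hint, hZ_def]
  congr 1
  funext x0
  rw [integral_mul_const, hpt0_int t ht x0, one_mul]
end

section
/- Let λ : [0,1] → [0,∞) be a probability density over time. For a measurable function b : [0,1] × ℝ^d → ℝ^d, define the energy-weighted flow matching loss L_EFM(b) := ∫_0^1 ∫ λ(t)·p_t(x)·(exp(−ℰ_t(x))/Z)·‖b(t,x) − û_t(x)‖² dx dt and the conditional energy-weighted flow matching loss L_CEFM(b) := ∫_0^1 ∫∫ λ(t)·p_0(x0)·p_{t0}(x|x0)·(exp(−β ℰ(x0))/Z)·‖b(t,x) − u_{t0}(x|x0)‖² dx0 dx dt, where û_t(x) := ∫ p_{0t}(x0|x)·u_{t0}(x|x0)·exp(−β ℰ(x0))/exp(−ℰ_t(x)) dx0. Assume that ∫_0^1 ∫ λ(t)·p_t(x)·(exp(−ℰ_t(x))/Z)·‖û_t(x)‖² dx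 dt and ∫_0^1 ∫∫ λ(t)·p_0(x0)·p_{t0}(x|x0)·(exp(−β ℰ(x0))/Z)·‖u_{t0}(x|x0)‖² dx0 dx dt are both finite. Then there exists a constant C ∈ ℝ, independent of b, such that for every b for which all the integrals above converge absolutely, L_EFM(b) = L_CEFM(b) + C; explicitly, C = ∫_0^1 ∫ λ(t)·p_t(x)·(exp(−ℰ_t(x))/Z)·‖û_t(x)‖² dx dt − ∫_0^1 ∫∫ λ(t)·p_0(x0)·p_{t0}(x|x0)·(exp(−β ℰ(x0))/Z)·‖u_{t0}(x|x0)‖² dx0 dx dt. -/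
open MeasureTheory Set

theorem efm_fun_sub {X : Type*} [MeasurableSpace X] {μ : Measure X} {f g : X → ℝ}
    (hf : Integrable f μ) (hg : Integrable g μ) : Integrable (fun x => f x - g x) μ :=
  hf.sub hg

theorem efm_pointwise {X E : Type*} [MeasurableSpace X] (μ : Measure X)
    [NormedAddCommGroup E] [InnerProductSpace ℝ E] [CompleteSpace E]
    (f : X → ℝ) (g : X → E) (hf0 : ∀ x, 0 ≤ f x) (hf : Integrable f μ)
    (hg : AEStronglyMeasurable g μ) (hfg : Integrable (fun x => f x * ‖g x‖ ^ 2) μ)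
    (b v : E) (hv : (∫ x, f x ∂μ) • v = ∫ x, f x • g x ∂μ) :
    (∫ x, f x ∂μ) * ‖b - v‖ ^ 2 =
      (∫ x, f x * ‖b - g x‖ ^ 2 ∂μ) + (∫ x, f x ∂μ) * ‖v‖ ^ 2 - ∫ x, f x * ‖g x‖ ^ 2 ∂μ := by
  have h1 : Integrable (fun x => f x • g x) μ := by
    refine (hf.add hfg).mono' (hf.aestronglyMeasurable.smul hg) ?_
    filter_upwards with x
    rw [norm_smul, Real.norm_of_nonneg (hf0 x)]
    simp only [Pi.add_apply]
    nlinarith [hf0 x, mul_nonneg (hf0 x) (sq_nonneg (‖g x‖ - 1)),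
      mul_nonneg (hf0 x) (sq_nonneg (‖g x‖))]
  have h2 : ∀ x, f x * ‖b - g x‖ ^ 2 =
      f x * ‖b‖ ^ 2 - 2 * inner ℝ b (f x • g x) + f x * ‖g x‖ ^ 2 := by
    intro x
    rw [norm_sub_sq_real, inner_smul_right]; ring
  have h3 : Integrable (fun x => 2 * inner ℝ b (f x • g x)) μ := (h1.const_inner b).const_mul 2
  have h4 : Integrable (fun x => f x * ‖b‖ ^ 2) μ := hf.mul_const _
  simp_rw [h2]
  rw [integral_add (efm_fun_sub h4 h3) hfg, integral_sub h4 h3, integral_mul_const, integral_const_mul,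
    integral_inner h1, ← hv, inner_smul_right, norm_sub_sq_real]
  ring

/-- The energy-weighted flow matching loss and the conditional
energy-weighted flow matching loss differ by a constant independent of `b`:
`L_EFM(b) = L_CEFM(b) + C` with
`C = ∫∫ λ p_t (e^{−ℰ_t}/Z) ‖û_t‖² − ∫∫∫ λ p_0 p_{t0} (e^{−βℰ}/Z) ‖u_{t0}‖²`. -/
theorem energy_weighted_flow_matching_loss_eq
    (d : ℕ) (hd : 1 ≤ d)
    (p0 : EuclideanSpace ℝ (Fin d) → ℝ)
    (En : EuclideanSpace ℝ (Fin d) → ℝ)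
    (β : ℝ) (hβ : 0 < β)
    (pt0 : ℝ → EuclideanSpace ℝ (Fin d) → EuclideanSpace ℝ (Fin d) → ℝ)
    (hp0_nonneg : ∀ x, 0 ≤ p0 x)
    (hp0_meas : Measurable p0)
    (hp0_int : ∫ x, p0 x = 1)
    (hEn_meas : Measurable En)
    (hpt0_nonneg : ∀ t ∈ Icc (0:ℝ) 1, ∀ x0 x, 0 ≤ pt0 t x0 x)
    (hpt0_meas : ∀ t ∈ Icc (0:ℝ) 1,
      Measurable (fun q : EuclideanSpace ℝ (Fin d) × EuclideanSpace ℝ (Fin d) => pt0 t q.1 q.2))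
    (hpt0_int : ∀ t ∈ Icc (0:ℝ) 1, ∀ x0, ∫ x, pt0 t x0 x = 1)
    (Z : ℝ)
    (hZ_def : Z = ∫ x0, p0 x0 * Real.exp (-β * En x0))
    (hZ_int : Integrable (fun x0 => p0 x0 * Real.exp (-β * En x0)))
    (hZ_pos : 0 < Z)
    (pt : ℝ → EuclideanSpace ℝ (Fin d) → ℝ)
    (hpt_def : ∀ t x, pt t x = ∫ x0, pt0 t x0 x * p0 x0)
    (hpt_pos : ∀ t ∈ Icc (0:ℝ) 1, ∀ x, 0 < pt t x)
    (p0t : ℝ → EuclideanSpace ℝ (Fin d) → EuclideanSpace ℝ (Fin d) → ℝ)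
    (hp0t_def : ∀ t x0 x, p0t t x0 x = pt0 t x0 x * p0 x0 / pt t x)
    (Et : ℝ → EuclideanSpace ℝ (Fin d) → ℝ)
    (hEt_def : ∀ t ∈ Icc (0:ℝ) 1, ∀ x,
      Real.exp (-(Et t x)) = ∫ x0, p0t t x0 x * Real.exp (-β * En x0))
    (hEt_int : ∀ t ∈ Icc (0:ℝ) 1, ∀ x,
      Integrable (fun x0 => p0t t x0 x * Real.exp (-β * En x0)))
    -- the jointly measurable family of conditional vector fields
    (u : ℝ → EuclideanSpace ℝ (Fin d) → EuclideanSpace ℝ (Fin d) → EuclideanSpace ℝ (Fin d))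
    (hu_meas : Measurable
      (fun q : ℝ × EuclideanSpace ℝ (Fin d) × EuclideanSpace ℝ (Fin d) => u q.1 q.2.1 q.2.2))
    -- `λ` is a probability density over time
    (lam : ℝ → ℝ)
    (hlam_nonneg : ∀ t, 0 ≤ lam t)
    (hlam_int : ∫ t in Icc (0:ℝ) 1, lam t = 1)
    -- the energy-guided vector field `û_t`
    (uhat : ℝ → EuclideanSpace ℝ (Fin d) → EuclideanSpace ℝ (Fin d))
    (huhat_def : ∀ t x, uhat t x =
      ∫ x0, (p0t t x0 x * Real.exp (-β * En x0) / Real.exp (-(Et t x))) • u t x0 x)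
    -- finiteness of the weighted second moments
    (hmom_uhat : Integrable
      (fun q : ℝ × EuclideanSpace ℝ (Fin d) =>
        lam q.1 * pt q.1 q.2 * (Real.exp (-(Et q.1 q.2)) / Z) * ‖uhat q.1 q.2‖ ^ 2)
      ((volume.restrict (Icc (0:ℝ) 1)).prod volume))
    (hmom_u : Integrable
      (fun q : ℝ × EuclideanSpace ℝ (Fin d) × EuclideanSpace ℝ (Fin d) =>
        lam q.1 * p0 q.2.2 * pt0 q.1 q.2.2 q.2.1 * (Real.exp (-β * En q.2.2) / Z) *
          ‖u q.1 q.2.2 q.2.1‖ ^ 2)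
      ((volume.restrict (Icc (0:ℝ) 1)).prod (volume.prod volume))) :
    ∃ C : ℝ,
      C = (∫ t in Icc (0:ℝ) 1, ∫ x,
            lam t * pt t x * (Real.exp (-(Et t x)) / Z) * ‖uhat t x‖ ^ 2) -
          (∫ t in Icc (0:ℝ) 1, ∫ x, ∫ x0,
            lam t * p0 x0 * pt0 t x0 x * (Real.exp (-β * En x0) / Z) * ‖u t x0 x‖ ^ 2) ∧
      ∀ b : ℝ → EuclideanSpace ℝ (Fin d) → EuclideanSpace ℝ (Fin d),
        Integrable
          (fun q : ℝ × EuclideanSpace ℝ (Fin d) =>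
            lam q.1 * pt q.1 q.2 * (Real.exp (-(Et q.1 q.2)) / Z) * ‖b q.1 q.2 - uhat q.1 q.2‖ ^ 2)
          ((volume.restrict (Icc (0:ℝ) 1)).prod volume) →
        Integrable
          (fun q : ℝ × EuclideanSpace ℝ (Fin d) × EuclideanSpace ℝ (Fin d) =>
            lam q.1 * p0 q.2.2 * pt0 q.1 q.2.2 q.2.1 * (Real.exp (-β * En q.2.2) / Z) *
              ‖b q.1 q.2.1 - u q.1 q.2.2 q.2.1‖ ^ 2)
          ((volume.restrict (Icc (0:ℝ) 1)).prod (volume.prod volume)) →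
        (∫ t in Icc (0:ℝ) 1, ∫ x,
            lam t * pt t x * (Real.exp (-(Et t x)) / Z) * ‖b t x - uhat t x‖ ^ 2) =
        (∫ t in Icc (0:ℝ) 1, ∫ x, ∫ x0,
            lam t * p0 x0 * pt0 t x0 x * (Real.exp (-β * En x0) / Z) *
              ‖b t x - u t x0 x‖ ^ 2) + C := by
  refine ⟨_, rfl, ?_⟩
  intro b hb1 hb2
  have key : ∀ t ∈ Icc (0:ℝ) 1, ∀ x, ∀ c : EuclideanSpace ℝ (Fin d),
      Integrable (fun x0 => lam t * p0 x0 * pt0 t x0 x * (Real.exp (-β * En x0) / Z) *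
        ‖u t x0 x‖ ^ 2) →
      lam t * pt t x * (Real.exp (-(Et t x)) / Z) * ‖c - uhat t x‖ ^ 2 =
      (∫ x0, lam t * p0 x0 * pt0 t x0 x * (Real.exp (-β * En x0) / Z) * ‖c - u t x0 x‖ ^ 2)
      + lam t * pt t x * (Real.exp (-(Et t x)) / Z) * ‖uhat t x‖ ^ 2
      - ∫ x0, lam t * p0 x0 * pt0 t x0 x * (Real.exp (-β * En x0) / Z) * ‖u t x0 x‖ ^ 2 := by
    intro t ht x c hi
    have hp := hpt_pos t ht x
    have e1 : ∀ x0, lam t * p0 x0 * pt0 t x0 x * (Real.exp (-β * En x0) / Z) =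
        (lam t * pt t x / Z) * (p0t t x0 x * Real.exp (-β * En x0)) := by
      intro x0
      rw [hp0t_def]
      field_simp
    have hint : Integrable
        (fun x0 => lam t * p0 x0 * pt0 t x0 x * (Real.exp (-β * En x0) / Z)) := by
      simp_rw [e1]
      exact (hEt_int t ht x).const_mul _
    have hval : ∫ x0, lam t * p0 x0 * pt0 t x0 x * (Real.exp (-β * En x0) / Z) =
        lam t * pt t x * (Real.exp (-(Et t x)) / Z) := by
      simp_rw [e1]
      rw [integral_const_mul, ← hEt_def t ht x]
      ring
    have hm : Measurable (fun x0 => u t x0 x) :=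
      hu_meas.comp (measurable_const.prodMk (measurable_id.prodMk measurable_const))
    have := efm_pointwise volume _ (fun x0 => u t x0 x) (fun x0 => by
        have := hlam_nonneg t
        have := hp0_nonneg x0
        have := hpt0_nonneg t ht x0 x
        positivity) hint hm.aestronglyMeasurable hi c (uhat t x) (by
        rw [hval, huhat_def, ← integral_smul]
        congr 1
        ext1 x0
        rw [smul_smul, e1]
        congr 1
        have := Real.exp_pos (-(Et t x))
        field_simp)
    rw [hval] at this
    exact this
  have A1 := hb1.prod_right_ae
  have A2 := hb2.prod_right_ae
  have A3 := hmom_uhat.prod_right_ae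
  have A4 := hmom_u.prod_right_ae
  have I1 := hb1.integral_prod_left
  have I2 := hb2.integral_prod_left
  have I3 := hmom_uhat.integral_prod_left
  have I4 := hmom_u.integral_prod_left
  have J2 := I2.congr (A2.mono fun t ht => integral_prod _ ht)
  have J4 := I4.congr (A4.mono fun t ht => integral_prod _ ht)
  dsimp only at I1 J2 I3 J4
  rw [← integral_sub I3 J4, ← integral_add J2 (efm_fun_sub I3 J4)]
  apply integral_congr_ae
  filter_upwards [A2, A3, A4, ae_restrict_mem measurableSet_Icc] with t a2 a3 a4 ht
  have i2 := a2.integral_prod_left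
  have i4 := a4.integral_prod_left
  dsimp only at i2 i4 a3
  rw [← integral_sub a3 i4, ← integral_add i2 (efm_fun_sub a3 i4)]
  apply integral_congr_ae
  filter_upwards [a4.prod_right_ae] with x hx
  have := key t ht x (b t x) hx
  rw [this]
  ring
end

section
/- With the losses L_EFM and L_CEFM defined as above and under the same finiteness assumptions, the guided field û minimizes both losses: for every measurable b : [0,1] × ℝ^d → ℝ^d for which the losses are defined and finite, L_CEFM(û) ≤ L_CEFM(b), where û(t,x) := û_t(x) = ∫ p_{0t}(x0|x)·u_{t0}(x|x0)·exp(−β ℰ(x0))/exp(−ℰ_t(x)) dx0. -/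
open MeasureTheory Set

theorem weighted_mean_min {E F : Type*} [NormedAddCommGroup E] [InnerProductSpace ℝ E]
    [CompleteSpace E] [MeasurableSpace F] (μ : Measure F) (w : F → ℝ) (v : F → E)
    (hw0 : ∀ y, 0 ≤ w y) (hw : Integrable w μ) (hw1 : ∫ y, w y ∂μ = 1)
    (hv : AEStronglyMeasurable v μ)
    (hwv : Integrable (fun y => w y * ‖v y‖ ^ 2) μ) (m b : E)
    (hm : m = ∫ y, w y • v y ∂μ) :
    ∫ y, w y * ‖m - v y‖ ^ 2 ∂μ ≤ ∫ y, w y * ‖b - v y‖ ^ 2 ∂μ := by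
  have hI : Integrable (fun y => w y • v y) μ := by
    refine Integrable.mono' (hw.add hwv) (hw.aestronglyMeasurable.smul hv) ?_
    refine Filter.Eventually.of_forall fun y => ?_
    simp only [Pi.add_apply]
    rw [norm_smul, Real.norm_of_nonneg (hw0 y)]
    nlinarith [mul_nonneg (hw0 y) (sq_nonneg (‖v y‖ - 1)), hw0 y,
      mul_nonneg (hw0 y) (sq_nonneg (‖v y‖))]
  have key : ∀ a : E, ∫ y, w y * ‖a - v y‖ ^ 2 ∂μ
      = ‖a‖ ^ 2 - 2 * inner ℝ a m + ∫ y, w y * ‖v y‖ ^ 2 ∂μ := by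
    intro a
    have e : ∀ y, w y * ‖a - v y‖ ^ 2
        = w y * ‖a‖ ^ 2 - 2 * inner ℝ a (w y • v y) + w y * ‖v y‖ ^ 2 := by
      intro y
      rw [norm_sub_sq_real, inner_smul_right]
      ring
    have i1 : Integrable (fun y => w y * ‖a‖ ^ 2) μ := hw.mul_const _
    have i2 : Integrable (fun y => 2 * inner ℝ a (w y • v y)) μ :=
      (hI.const_inner a).const_mul 2
    have i3 : Integrable (fun y => w y * ‖a‖ ^ 2 - 2 * inner ℝ a (w y • v y)) μ := i1.sub i2
    simp_rw [e]
    rw [integral_add i3 hwv, integral_sub i1 i2, integral_mul_const, hw1,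
      integral_const_mul, integral_inner hI, ← hm, one_mul]
  rw [key m, key b, real_inner_self_eq_norm_sq]
  have := sq_nonneg ‖b - m‖
  rw [norm_sub_sq_real] at this
  linarith

/-- The energy-guided field `û` minimizes the conditional energy-weighted
flow matching loss: for every measurable `b` for which the losses are defined and finite,
`L_CEFM(û) ≤ L_CEFM(b)`. -/
theorem energy_guided_field_minimizes_CEFM
    (d : ℕ) (hd : 1 ≤ d)
    (p0 : EuclideanSpace ℝ (Fin d) → ℝ)
    (En : EuclideanSpace ℝ (Fin d) → ℝ)
    (β : ℝ) (hβ : 0 < β)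
    (pt0 : ℝ → EuclideanSpace ℝ (Fin d) → EuclideanSpace ℝ (Fin d) → ℝ)
    (hp0_nonneg : ∀ x, 0 ≤ p0 x)
    (hp0_meas : Measurable p0)
    (hp0_int : ∫ x, p0 x = 1)
    (hEn_meas : Measurable En)
    (hpt0_nonneg : ∀ t ∈ Icc (0:ℝ) 1, ∀ x0 x, 0 ≤ pt0 t x0 x)
    (hpt0_meas : ∀ t ∈ Icc (0:ℝ) 1,
      Measurable (fun q : EuclideanSpace ℝ (Fin d) × EuclideanSpace ℝ (Fin d) => pt0 t q.1 q.2))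
    (hpt0_int : ∀ t ∈ Icc (0:ℝ) 1, ∀ x0, ∫ x, pt0 t x0 x = 1)
    (Z : ℝ)
    (hZ_def : Z = ∫ x0, p0 x0 * Real.exp (-β * En x0))
    (hZ_int : Integrable (fun x0 => p0 x0 * Real.exp (-β * En x0)))
    (hZ_pos : 0 < Z)
    (pt : ℝ → EuclideanSpace ℝ (Fin d) → ℝ)
    (hpt_def : ∀ t x, pt t x = ∫ x0, pt0 t x0 x * p0 x0)
    (hpt_pos : ∀ t ∈ Icc (0:ℝ) 1, ∀ x, 0 < pt t x)
    (p0t : ℝ → EuclideanSpace ℝ (Fin d) → EuclideanSpace ℝ (Fin d) → ℝ)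
    (hp0t_def : ∀ t x0 x, p0t t x0 x = pt0 t x0 x * p0 x0 / pt t x)
    (Et : ℝ → EuclideanSpace ℝ (Fin d) → ℝ)
    (hEt_def : ∀ t ∈ Icc (0:ℝ) 1, ∀ x,
      Real.exp (-(Et t x)) = ∫ x0, p0t t x0 x * Real.exp (-β * En x0))
    (hEt_int : ∀ t ∈ Icc (0:ℝ) 1, ∀ x,
      Integrable (fun x0 => p0t t x0 x * Real.exp (-β * En x0)))
    (u : ℝ → EuclideanSpace ℝ (Fin d) → EuclideanSpace ℝ (Fin d) → EuclideanSpace ℝ (Fin d))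
    (hu_meas : Measurable
      (fun q : ℝ × EuclideanSpace ℝ (Fin d) × EuclideanSpace ℝ (Fin d) => u q.1 q.2.1 q.2.2))
    (lam : ℝ → ℝ)
    (hlam_nonneg : ∀ t, 0 ≤ lam t)
    (hlam_int : ∫ t in Icc (0:ℝ) 1, lam t = 1)
    -- the energy-guided vector field `û`
    (uhat : ℝ → EuclideanSpace ℝ (Fin d) → EuclideanSpace ℝ (Fin d))
    (huhat_def : ∀ t x, uhat t x =
      ∫ x0, (p0t t x0 x * Real.exp (-β * En x0) / Real.exp (-(Et t x))) • u t x0 x)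
    -- finiteness of the weighted second moments
    (hmom_uhat : Integrable
      (fun q : ℝ × EuclideanSpace ℝ (Fin d) =>
        lam q.1 * pt q.1 q.2 * (Real.exp (-(Et q.1 q.2)) / Z) * ‖uhat q.1 q.2‖ ^ 2)
      ((volume.restrict (Icc (0:ℝ) 1)).prod volume))
    (hmom_u : Integrable
      (fun q : ℝ × EuclideanSpace ℝ (Fin d) × EuclideanSpace ℝ (Fin d) =>
        lam q.1 * p0 q.2.2 * pt0 q.1 q.2.2 q.2.1 * (Real.exp (-β * En q.2.2) / Z) *
          ‖u q.1 q.2.2 q.2.1‖ ^ 2)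
      ((volume.restrict (Icc (0:ℝ) 1)).prod (volume.prod volume))) :
    ∀ b : ℝ → EuclideanSpace ℝ (Fin d) → EuclideanSpace ℝ (Fin d),
      Measurable (fun q : ℝ × EuclideanSpace ℝ (Fin d) => b q.1 q.2) →
      Integrable
        (fun q : ℝ × EuclideanSpace ℝ (Fin d) × EuclideanSpace ℝ (Fin d) =>
          lam q.1 * p0 q.2.2 * pt0 q.1 q.2.2 q.2.1 * (Real.exp (-β * En q.2.2) / Z) *
            ‖b q.1 q.2.1 - u q.1 q.2.2 q.2.1‖ ^ 2)
        ((volume.restrict (Icc (0:ℝ) 1)).prod (volume.prod volume)) →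
      (∫ t in Icc (0:ℝ) 1, ∫ x, ∫ x0,
          lam t * p0 x0 * pt0 t x0 x * (Real.exp (-β * En x0) / Z) *
            ‖uhat t x - u t x0 x‖ ^ 2) ≤
      (∫ t in Icc (0:ℝ) 1, ∫ x, ∫ x0,
          lam t * p0 x0 * pt0 t x0 x * (Real.exp (-β * En x0) / Z) *
            ‖b t x - u t x0 x‖ ^ 2) := by
  intro b hb hbi
  have h1 := hbi.prod_right_ae
  have h2 := hmom_u.prod_right_ae
  have h3 := hbi.integral_prod_left
  have hmem : ∀ᵐ t ∂(volume.restrict (Icc (0:ℝ) 1)), t ∈ Icc (0:ℝ) 1 :=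
    ae_restrict_mem measurableSet_Icc
  have hnn : ∀ t ∈ Icc (0:ℝ) 1, ∀ x x0, 0 ≤ lam t * p0 x0 * pt0 t x0 x *
      (Real.exp (-β * En x0) / Z) := fun t ht x x0 =>
    mul_nonneg (mul_nonneg (mul_nonneg (hlam_nonneg t) (hp0_nonneg x0)) (hpt0_nonneg t ht x0 x))
      (div_nonneg (Real.exp_pos _).le hZ_pos.le)
  refine integral_mono_of_nonneg ?_ ?_ ?_
  · filter_upwards [hmem] with t ht
    exact integral_nonneg fun x => integral_nonneg fun x0 =>
      mul_nonneg (hnn t ht x x0) (sq_nonneg _)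
  · refine h3.congr ?_
    filter_upwards [h1] with t ht
    exact integral_prod _ ht
  filter_upwards [hmem, h1, h2] with t ht h1t h2t
  refine integral_mono_of_nonneg ?_ h1t.integral_prod_left ?_
  · exact Filter.Eventually.of_forall fun x => integral_nonneg fun x0 =>
      mul_nonneg (hnn t ht x x0) (sq_nonneg _)
  filter_upwards [h2t.prod_right_ae] with x hx
  have hptp := hpt_pos t ht x
  have hexp := Real.exp_pos (-(Et t x))
  set c : ℝ := lam t * pt t x * Real.exp (-(Et t x)) / Z with hc
  set w : EuclideanSpace ℝ (Fin d) → ℝ := fun x0 =>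
    p0t t x0 x * Real.exp (-β * En x0) / Real.exp (-(Et t x)) with hwdef
  have hcw : ∀ x0, lam t * p0 x0 * pt0 t x0 x * (Real.exp (-β * En x0) / Z) = c * w x0 := by
    intro x0
    simp only [hc, hwdef, hp0t_def]
    field_simp
  simp only [hcw] at hx ⊢
  simp only [mul_assoc c] at hx ⊢
  rw [integral_const_mul, integral_const_mul]
  have hc0 : 0 ≤ c := div_nonneg (mul_nonneg (mul_nonneg (hlam_nonneg t) hptp.le) hexp.le) hZ_pos.le
  rcases hc0.eq_or_lt with h0 | hcpos
  · rw [← h0]; simp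
  refine mul_le_mul_of_nonneg_left ?_ hc0
  refine weighted_mean_min volume w (fun x0 => u t x0 x) ?_ ((hEt_int t ht x).div_const _) ?_ ?_ ?_
    _ _ (huhat_def t x)
  · intro x0
    simp only [hwdef, hp0t_def]
    exact div_nonneg (mul_nonneg (div_nonneg (mul_nonneg (hpt0_nonneg t ht x0 x) (hp0_nonneg x0))
      hptp.le) (Real.exp_pos _).le) hexp.le
  · simp only [hwdef]
    rw [integral_div, ← hEt_def t ht x, div_self hexp.ne']
  · have : Measurable (fun x0 => u t x0 x) :=
      hu_meas.comp (measurable_const.prodMk (measurable_id.prodMk measurable_const))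
    exact this.aestronglyMeasurable
  · refine (hx.const_mul c⁻¹).congr (Filter.Eventually.of_forall fun x0 => ?_)
    simp only
    rw [inv_mul_cancel_left₀ hcpos.ne']
end

section
/- Under the Gaussian path, fix t ∈ (0,1] and x ∈ ℝ^d, let q_t(x) := p_t(x)·exp(−ℰ_t(x))/Z, and assume that the function x ↦ ∫ p_{t0}(x|x0)·p_0(x0)·exp(−β ℰ(x0)) dx0 is differentiable at x with gradient obtained by differentiating under the integral sign. Then ∇_x log q_t(x) = ∫ p_{0t}(x0|x)·( −(x − μ_t x0)/σ_t² )·( exp(−β ℰ(x0))/exp(−ℰ_t(x)) ) dx0, i.e., the guided score is the posterior average of the conditional Gaussian scores ∇_x log p_{t0}(x|x0) reweighted by exp(−β ℰ(x0))/exp(−ℰ_t(x)). -/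
open MeasureTheory Set

/-- Under the Gaussian path, the guided score is the posterior average
of the conditional Gaussian scores reweighted by `exp(−β ℰ(x0))/exp(−ℰ_t(x))`:
`∇ log q_t(x) = ∫ p_{0t}(x0|x) · (−(x − μ_t x0)/σ_t²) · (e^{−βℰ(x0)}/e^{−ℰ_t(x)}) dx0`. -/
theorem gaussian_path_guided_score
    (d : ℕ) (hd : 1 ≤ d)
    (p0 : EuclideanSpace ℝ (Fin d) → ℝ)
    (En : EuclideanSpace ℝ (Fin d) → ℝ)
    (β : ℝ) (hβ : 0 < β)
    -- Gaussian path schedulers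
    (μ σ : ℝ → ℝ) (hσ : ∀ t, 0 < σ t)
    (pt0 : ℝ → EuclideanSpace ℝ (Fin d) → EuclideanSpace ℝ (Fin d) → ℝ)
    (hpt0_def : ∀ t x0 y, pt0 t x0 y =
      (2 * Real.pi * σ t ^ 2) ^ (-(d : ℝ) / 2) *
        Real.exp (-‖y - μ t • x0‖ ^ 2 / (2 * σ t ^ 2)))
    (hp0_nonneg : ∀ x, 0 ≤ p0 x)
    (hp0_meas : Measurable p0)
    (hp0_int : ∫ x, p0 x = 1)
    (hEn_meas : Measurable En)
    (Z : ℝ)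
    (hZ_def : Z = ∫ x0, p0 x0 * Real.exp (-β * En x0))
    (hZ_int : Integrable (fun x0 => p0 x0 * Real.exp (-β * En x0)))
    (hZ_pos : 0 < Z)
    (pt : ℝ → EuclideanSpace ℝ (Fin d) → ℝ)
    (hpt_def : ∀ t x, pt t x = ∫ x0, pt0 t x0 x * p0 x0)
    (hpt_pos : ∀ t ∈ Icc (0:ℝ) 1, ∀ x, 0 < pt t x)
    (p0t : ℝ → EuclideanSpace ℝ (Fin d) → EuclideanSpace ℝ (Fin d) → ℝ)
    (hp0t_def : ∀ t x0 x, p0t t x0 x = pt0 t x0 x * p0 x0 / pt t x)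
    (Et : ℝ → EuclideanSpace ℝ (Fin d) → ℝ)
    (hEt_def : ∀ t ∈ Icc (0:ℝ) 1, ∀ x,
      Real.exp (-(Et t x)) = ∫ x0, p0t t x0 x * Real.exp (-β * En x0))
    (hEt_int : ∀ t ∈ Icc (0:ℝ) 1, ∀ x,
      Integrable (fun x0 => p0t t x0 x * Real.exp (-β * En x0)))
    -- fix `t ∈ (0,1]` and `x`
    (t : ℝ) (ht : t ∈ Ioc (0:ℝ) 1)
    (x : EuclideanSpace ℝ (Fin d))
    -- differentiation under the integral sign for `x ↦ ∫ p_{t0}(x|x0) p_0(x0) e^{−βℰ(x0)} dx0`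
    (hDUI : HasGradientAt
      (fun y => ∫ x0, pt0 t x0 y * (p0 x0 * Real.exp (-β * En x0)))
      (∫ x0, (p0 x0 * Real.exp (-β * En x0)) • gradient (fun y => pt0 t x0 y) x) x) :
    DifferentiableAt ℝ (fun y => pt t y * Real.exp (-(Et t y)) / Z) x ∧
    (pt t x * Real.exp (-(Et t x)) / Z)⁻¹ •
        gradient (fun y => pt t y * Real.exp (-(Et t y)) / Z) x =
      ∫ x0, (p0t t x0 x * (Real.exp (-β * En x0) / Real.exp (-(Et t x)))) •
        (-((σ t ^ 2)⁻¹ • (x - μ t • x0))) := by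
  have htI : t ∈ Icc (0:ℝ) 1 := ⟨ht.1.le, ht.2⟩
  have hF : ∀ y, pt t y * Real.exp (-(Et t y)) =
      ∫ x0, pt0 t x0 y * (p0 x0 * Real.exp (-β * En x0)) := by
    intro y
    rw [hEt_def t htI y, ← integral_const_mul]
    refine integral_congr_ae (Filter.Eventually.of_forall fun x0 => ?_)
    have := (hpt_pos t htI y).ne'
    simp only [hp0t_def]
    field_simp
  have hgrad : ∀ x0, gradient (fun y => pt0 t x0 y) x =
      pt0 t x0 x • (-((σ t ^ 2)⁻¹ • (x - μ t • x0))) := by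
    intro x0
    apply HasGradientAt.gradient
    rw [hasGradientAt_iff_hasFDerivAt]
    have hs := (hσ t).ne'
    have h1 : HasFDerivAt (fun y : EuclideanSpace ℝ (Fin d) => ‖y - μ t • x0‖ ^ 2)
        _ x := ((hasFDerivAt_id x).sub_const (μ t • x0)).norm_sq
    have h2 := (((h1.neg.mul_const (2 * σ t ^ 2)⁻¹).exp).const_mul
      ((2 * Real.pi * σ t ^ 2) ^ (-(d : ℝ) / 2)))
    have he : (fun y => pt0 t x0 y) = fun y => (2 * Real.pi * σ t ^ 2) ^ (-(d : ℝ) / 2) *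
        Real.exp (-‖y - μ t • x0‖ ^ 2 * (2 * σ t ^ 2)⁻¹) := by
      funext y
      simp only [hpt0_def, div_eq_mul_inv]
    rw [he]
    refine h2.congr_fderiv ?_
    ext v
    rw [hpt0_def]
    simp [div_eq_mul_inv, inner_smul_left, inner_neg_left]
    field_simp
  have hfun : (fun y => pt t y * Real.exp (-(Et t y)) / Z) =
      fun y => Z⁻¹ * ∫ x0, pt0 t x0 y * (p0 x0 * Real.exp (-β * En x0)) := by
    funext y
    rw [hF y, div_eq_inv_mul]
  have hG : HasGradientAt (fun y => pt t y * Real.exp (-(Et t y)) / Z)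
      (Z⁻¹ • ∫ x0, (p0 x0 * Real.exp (-β * En x0)) • gradient (fun y => pt0 t x0 y) x) x := by
    rw [hfun, hasGradientAt_iff_hasFDerivAt]
    rw [hasGradientAt_iff_hasFDerivAt] at hDUI
    refine (hDUI.const_mul Z⁻¹).congr_fderiv ?_
    simp
  refine ⟨hG.differentiableAt, ?_⟩
  rw [hG.gradient, ← integral_smul, ← integral_smul]
  refine integral_congr_ae (Filter.Eventually.of_forall fun x0 => ?_)
  simp only [hgrad, smul_smul, hp0t_def]
  congr 1
  have := (hpt_pos t htI x).ne'
  have := (Real.exp_pos (-(Et t x))).ne'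
  have := hZ_pos.ne'
  field_simp
end

section
/- Under the Gaussian path, let λ : [0,1] → [0,∞) be a probability density over time and let q_t(x) := p_t(x)·exp(−ℰ_t(x))/Z, assumed differentiable in x with ∇_x log q_t(x) = ∫ p_{0t}(x0|x)·(−(x − μ_t x0)/σ_t²)·(exp(−β ℰ(x0))/exp(−ℰ_t(x))) dx0 (differentiation under the integral sign). For a measurable s : [0,1] × ℝ^d → ℝ^d, define the energy-weighted diffusion loss L_ED(s) := ∫_0^1 ∫ λ(t)·p_t(x)·(exp(−ℰ_t(x))/Z)·‖s(t,x) − ∇_x log q_t(x)‖² dx dt and the conditional energy-weighted diffusion loss L_CED(s) := ∫_0^1 ∫∫ λ(t)·p_0(x0)·p_{t0}(x|x0)·(exp(−β ℰ(x0))/Z)·‖s(t,x) + (x − μ_t x0)/σ_t²‖² dx0 dx dt. Assume the corresponding weighted second moments of ∇_x log q_t and of (x − μ_t x0)/σ_t² are finite. Then there exists a constant C ∈ ℝ, independent of s, such that L_ED(s) = L_CED(s) + C for every s for which all the integrals converge absolutely. -/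
open MeasureTheory Set

lemma ewd_expand {E : Type*} [NormedAddCommGroup E] [InnerProductSpace ℝ E] [CompleteSpace E]
    {X : Type*} [MeasurableSpace X] (ν : Measure X) (g : X → ℝ) (a : X → E) (M : ℝ) (s v : E)
    (hg : Integrable g ν) (hga : Integrable (fun y => g y • a y) ν)
    (hg2 : Integrable (fun y => g y * ‖a y‖ ^ 2) ν)
    (hM : ∫ y, g y ∂ν = M) (hv : ∫ y, g y • a y ∂ν = -(M • v)) :
    ∫ y, g y * ‖s + a y‖ ^ 2 ∂ν
      = M * ‖s - v‖ ^ 2 - M * ‖v‖ ^ 2 + ∫ y, g y * ‖a y‖ ^ 2 ∂ν := by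
  have h1 : ∀ y, g y * ‖s + a y‖ ^ 2
      = g y * ‖s‖ ^ 2 + 2 * inner ℝ s (g y • a y) + g y * ‖a y‖ ^ 2 := by
    intro y
    rw [norm_add_sq_real, inner_smul_right]
    ring
  have hi : Integrable (fun y => inner ℝ s (g y • a y)) ν := hga.const_inner s
  have h3 : Integrable (fun y => g y * ‖s‖ ^ 2 + 2 * inner ℝ s (g y • a y)) ν :=
    (hg.mul_const _).add (hi.const_mul 2)
  simp_rw [h1]
  rw [integral_add h3 hg2,
    integral_add (hg.mul_const _) (hi.const_mul 2), integral_mul_const, integral_const_mul,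
    integral_inner hga, hv, hM, inner_neg_right, inner_smul_right, norm_sub_sq_real]
  ring

/-- Under the Gaussian path, the energy-weighted diffusion loss `L_ED`
and the conditional energy-weighted diffusion loss `L_CED` differ by a constant
independent of `s`: `L_ED(s) = L_CED(s) + C`. -/
theorem energy_weighted_diffusion_loss_eq
    (d : ℕ) (hd : 1 ≤ d)
    (p0 : EuclideanSpace ℝ (Fin d) → ℝ)
    (En : EuclideanSpace ℝ (Fin d) → ℝ)
    (β : ℝ) (hβ : 0 < β)
    (μ σ : ℝ → ℝ) (hσ : ∀ t, 0 < σ t)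
    (pt0 : ℝ → EuclideanSpace ℝ (Fin d) → EuclideanSpace ℝ (Fin d) → ℝ)
    (hpt0_def : ∀ t x0 y, pt0 t x0 y =
      (2 * Real.pi * σ t ^ 2) ^ (-(d : ℝ) / 2) *
        Real.exp (-‖y - μ t • x0‖ ^ 2 / (2 * σ t ^ 2)))
    (hp0_nonneg : ∀ x, 0 ≤ p0 x)
    (hp0_meas : Measurable p0)
    (hp0_int : ∫ x, p0 x = 1)
    (hEn_meas : Measurable En)
    (Z : ℝ)
    (hZ_def : Z = ∫ x0, p0 x0 * Real.exp (-β * En x0))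
    (hZ_int : Integrable (fun x0 => p0 x0 * Real.exp (-β * En x0)))
    (hZ_pos : 0 < Z)
    (pt : ℝ → EuclideanSpace ℝ (Fin d) → ℝ)
    (hpt_def : ∀ t x, pt t x = ∫ x0, pt0 t x0 x * p0 x0)
    (hpt_pos : ∀ t ∈ Icc (0:ℝ) 1, ∀ x, 0 < pt t x)
    (p0t : ℝ → EuclideanSpace ℝ (Fin d) → EuclideanSpace ℝ (Fin d) → ℝ)
    (hp0t_def : ∀ t x0 x, p0t t x0 x = pt0 t x0 x * p0 x0 / pt t x)
    (Et : ℝ → EuclideanSpace ℝ (Fin d) → ℝ)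
    (hEt_def : ∀ t ∈ Icc (0:ℝ) 1, ∀ x,
      Real.exp (-(Et t x)) = ∫ x0, p0t t x0 x * Real.exp (-β * En x0))
    (hEt_int : ∀ t ∈ Icc (0:ℝ) 1, ∀ x,
      Integrable (fun x0 => p0t t x0 x * Real.exp (-β * En x0)))
    -- `λ` is a probability density over time
    (lam : ℝ → ℝ)
    (hlam_nonneg : ∀ t, 0 ≤ lam t)
    (hlam_int : ∫ t in Icc (0:ℝ) 1, lam t = 1)
    -- the energy-guided density `q_t` and its score `∇ log q_t`
    (qt : ℝ → EuclideanSpace ℝ (Fin d) → ℝ)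
    (hqt_def : ∀ t x, qt t x = pt t x * Real.exp (-(Et t x)) / Z)
    (slogq : ℝ → EuclideanSpace ℝ (Fin d) → EuclideanSpace ℝ (Fin d))
    (hq_diff : ∀ t ∈ Icc (0:ℝ) 1, ∀ x, DifferentiableAt ℝ (fun y => qt t y) x)
    (hslogq_grad : ∀ t ∈ Icc (0:ℝ) 1, ∀ x,
      slogq t x = (qt t x)⁻¹ • gradient (fun y => qt t y) x)
    -- differentiation under the integral sign for the score
    (hslogq_def : ∀ t ∈ Icc (0:ℝ) 1, ∀ x,
      slogq t x = ∫ x0, (p0t t x0 x * (Real.exp (-β * En x0) / Real.exp (-(Et t x)))) •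
        (-((σ t ^ 2)⁻¹ • (x - μ t • x0))))
    -- finiteness of the weighted second moments
    (hmom_score : Integrable
      (fun q : ℝ × EuclideanSpace ℝ (Fin d) =>
        lam q.1 * pt q.1 q.2 * (Real.exp (-(Et q.1 q.2)) / Z) * ‖slogq q.1 q.2‖ ^ 2)
      ((volume.restrict (Icc (0:ℝ) 1)).prod volume))
    (hmom_cond : Integrable
      (fun q : ℝ × EuclideanSpace ℝ (Fin d) × EuclideanSpace ℝ (Fin d) =>
        lam q.1 * p0 q.2.2 * pt0 q.1 q.2.2 q.2.1 * (Real.exp (-β * En q.2.2) / Z) *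
          ‖(σ q.1 ^ 2)⁻¹ • (q.2.1 - μ q.1 • q.2.2)‖ ^ 2)
      ((volume.restrict (Icc (0:ℝ) 1)).prod (volume.prod volume))) :
    ∃ C : ℝ,
      C = (∫ t in Icc (0:ℝ) 1, ∫ x,
            lam t * pt t x * (Real.exp (-(Et t x)) / Z) * ‖slogq t x‖ ^ 2) -
          (∫ t in Icc (0:ℝ) 1, ∫ x, ∫ x0,
            lam t * p0 x0 * pt0 t x0 x * (Real.exp (-β * En x0) / Z) *
              ‖(σ t ^ 2)⁻¹ • (x - μ t • x0)‖ ^ 2) ∧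
      ∀ s : ℝ → EuclideanSpace ℝ (Fin d) → EuclideanSpace ℝ (Fin d),
        Integrable
          (fun q : ℝ × EuclideanSpace ℝ (Fin d) =>
            lam q.1 * pt q.1 q.2 * (Real.exp (-(Et q.1 q.2)) / Z) *
              ‖s q.1 q.2 - slogq q.1 q.2‖ ^ 2)
          ((volume.restrict (Icc (0:ℝ) 1)).prod volume) →
        Integrable
          (fun q : ℝ × EuclideanSpace ℝ (Fin d) × EuclideanSpace ℝ (Fin d) =>
            lam q.1 * p0 q.2.2 * pt0 q.1 q.2.2 q.2.1 * (Real.exp (-β * En q.2.2) / Z) *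
              ‖s q.1 q.2.1 + (σ q.1 ^ 2)⁻¹ • (q.2.1 - μ q.1 • q.2.2)‖ ^ 2)
          ((volume.restrict (Icc (0:ℝ) 1)).prod (volume.prod volume)) →
        (∫ t in Icc (0:ℝ) 1, ∫ x,
            lam t * pt t x * (Real.exp (-(Et t x)) / Z) * ‖s t x - slogq t x‖ ^ 2) =
        (∫ t in Icc (0:ℝ) 1, ∫ x, ∫ x0,
            lam t * p0 x0 * pt0 t x0 x * (Real.exp (-β * En x0) / Z) *
              ‖s t x + (σ t ^ 2)⁻¹ • (x - μ t • x0)‖ ^ 2) + C := by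
  refine ⟨_, rfl, ?_⟩
  intro s hF hK
  -- pointwise identity
  have key : ∀ t ∈ Icc (0:ℝ) 1, ∀ x,
      (∫ x0, lam t * p0 x0 * pt0 t x0 x * (Real.exp (-β * En x0) / Z) *
              ‖s t x + (σ t ^ 2)⁻¹ • (x - μ t • x0)‖ ^ 2)
      = lam t * pt t x * (Real.exp (-(Et t x)) / Z) * ‖s t x - slogq t x‖ ^ 2
        - lam t * pt t x * (Real.exp (-(Et t x)) / Z) * ‖slogq t x‖ ^ 2
        + ∫ x0, lam t * p0 x0 * pt0 t x0 x * (Real.exp (-β * En x0) / Z) *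
              ‖(σ t ^ 2)⁻¹ • (x - μ t • x0)‖ ^ 2 := by
    intro t ht x
    have hp := hpt_pos t ht x
    have hs := hσ t
    have he := Real.exp_pos (-(Et t x))
    set e := Real.exp (-(Et t x)) with he_def
    let g : EuclideanSpace ℝ (Fin d) → ℝ :=
      fun x0 => pt t x * (p0t t x0 x * Real.exp (-β * En x0))
    let a : EuclideanSpace ℝ (Fin d) → EuclideanSpace ℝ (Fin d) :=
      fun x0 => (σ t ^ 2)⁻¹ • (x - μ t • x0)
    have hg_eq : ∀ x0, g x0 = pt0 t x0 x * (p0 x0 * Real.exp (-β * En x0)) := by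
      intro x0
      simp only [g, hp0t_def]
      field_simp
    have hg : Integrable g := (hEt_int t ht x).const_mul _
    have hM : ∫ x0, g x0 = pt t x * e := by
      simp only [g]
      rw [integral_const_mul, ← hEt_def t ht x]
    have ha_cont : Continuous a := by fun_prop
    have hg_nn : ∀ x0, 0 ≤ g x0 := by
      intro x0
      rw [hg_eq, hpt0_def]
      have := hp0_nonneg x0
      positivity
    have hg2 : Integrable (fun x0 => g x0 * ‖a x0‖ ^ 2) := by
      refine (hZ_int.const_mul
        ((2 * Real.pi * σ t ^ 2) ^ (-(d : ℝ) / 2) * (2 / σ t ^ 2))).mono'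
        (hg.aestronglyMeasurable.mul (ha_cont.norm.pow 2).aestronglyMeasurable) ?_
      filter_upwards with x0
      rw [Real.norm_of_nonneg (mul_nonneg (hg_nn x0) (by positivity)), hg_eq, hpt0_def]
      have hP := hp0_nonneg x0
      have hr : Real.exp (-‖x - μ t • x0‖ ^ 2 / (2 * σ t ^ 2)) * ‖a x0‖ ^ 2 ≤ 2 / σ t ^ 2 := by
        simp only [a]
        rw [norm_smul, Real.norm_of_nonneg (by positivity)]
        set r := ‖x - μ t • x0‖
        have h1 := Real.add_one_le_exp (r ^ 2 / (2 * σ t ^ 2))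
        rw [neg_div, Real.exp_neg]
        have h2 : ((σ t ^ 2)⁻¹ * r) ^ 2 = 2 / σ t ^ 2 * (r ^ 2 / (2 * σ t ^ 2)) := by
          field_simp
        rw [h2, inv_mul_le_iff₀ (Real.exp_pos _), mul_comm (Real.exp _)]
        gcongr
        linarith
      calc _ = (2 * Real.pi * σ t ^ 2) ^ (-(d : ℝ) / 2) *
              (Real.exp (-‖x - μ t • x0‖ ^ 2 / (2 * σ t ^ 2)) * ‖a x0‖ ^ 2) *
              (p0 x0 * Real.exp (-β * En x0)) := by ring
        _ ≤ _ := by gcongr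
    have hga : Integrable (fun x0 => g x0 • a x0) := by
      refine (hg.add hg2).mono'
        (hg.aestronglyMeasurable.smul ha_cont.aestronglyMeasurable) ?_
      filter_upwards with x0
      rw [norm_smul, Real.norm_of_nonneg (hg_nn x0)]
      simp only [Pi.add_apply]
      nlinarith [mul_nonneg (hg_nn x0) (sq_nonneg (‖a x0‖ - 1)),
        mul_nonneg (hg_nn x0) (sq_nonneg (‖a x0‖)), hg_nn x0]
    have hv : ∫ x0, g x0 • a x0 = -((pt t x * e) • slogq t x) := by
      rw [hslogq_def t ht x, ← integral_smul, ← integral_neg]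
      congr 1
      funext x0
      change g x0 • a x0 = -((pt t x * e) •
        ((p0t t x0 x * (Real.exp (-β * En x0) / e)) • (-(a x0))))
      rw [smul_neg, smul_neg, neg_neg, smul_smul (pt t x * e)]
      congr 1
      simp only [g]
      field_simp
    have hw : ∀ x0 r, lam t * p0 x0 * pt0 t x0 x * (Real.exp (-β * En x0) / Z) * r
        = lam t / Z * (g x0 * r) := by
      intro x0 r
      rw [hg_eq]
      ring
    have h := ewd_expand volume g a (pt t x * e) (s t x) (slogq t x) hg hga hg2 hM hv
    simp_rw [hw]
    rw [integral_const_mul, integral_const_mul]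
    simp only [a] at h
    rw [h]
    ring
  -- joint integrability of the conditional second moment
  have hH : Integrable (fun q : ℝ × EuclideanSpace ℝ (Fin d) =>
      ∫ x0, lam q.1 * p0 x0 * pt0 q.1 x0 q.2 * (Real.exp (-β * En x0) / Z) *
              ‖(σ q.1 ^ 2)⁻¹ • (q.2 - μ q.1 • x0)‖ ^ 2)
      ((volume.restrict (Icc (0:ℝ) 1)).prod volume) := by
    have hmp := measurePreserving_prodAssoc (volume.restrict (Icc (0:ℝ) 1))
      (volume : Measure (EuclideanSpace ℝ (Fin d))) (volume : Measure (EuclideanSpace ℝ (Fin d)))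
    exact (hmp.integrable_comp_of_integrable hmom_cond).integral_prod_left
  have e1 : (∫ t in Icc (0:ℝ) 1, ∫ x, ∫ x0,
            lam t * p0 x0 * pt0 t x0 x * (Real.exp (-β * En x0) / Z) *
              ‖s t x + (σ t ^ 2)⁻¹ • (x - μ t • x0)‖ ^ 2)
      = ∫ t in Icc (0:ℝ) 1, ∫ x,
        (lam t * pt t x * (Real.exp (-(Et t x)) / Z) * ‖s t x - slogq t x‖ ^ 2
        - lam t * pt t x * (Real.exp (-(Et t x)) / Z) * ‖slogq t x‖ ^ 2
        + ∫ x0, lam t * p0 x0 * pt0 t x0 x * (Real.exp (-β * En x0) / Z) *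
              ‖(σ t ^ 2)⁻¹ • (x - μ t • x0)‖ ^ 2) := by
    refine setIntegral_congr_fun measurableSet_Icc fun t ht => ?_
    exact integral_congr_ae (Filter.Eventually.of_forall fun x => key t ht x)
  rw [e1]
  have i1 := integral_prod _ hF
  have i2 := integral_prod _ hmom_score
  have i3 := integral_prod _ hH
  have i4 := integral_prod _ ((hF.sub hmom_score).add hH)
  have i5 := integral_add (hF.sub hmom_score) hH
  have i6 := integral_sub hF hmom_score
  simp only [Pi.add_apply, Pi.sub_apply] at i1 i2 i3 i4 i5 i6
  rw [← i4, i5, i6, ← i1, ← i2, ← i3]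
  ring
end

section
/- Let p_c : ℝ^d → (0,1] be a measurable classifier likelihood and take the energy ℰ(x0) := −log p_c(x0), so that q_0(x0) := p_0(x0)·p_c(x0)^β/Z. Fix t and x, assume p_t and the function x ↦ ∫ p_{t0}(x|x0)·p_0(x0)·p_c(x0)^β dx0 are differentiable at x. Then exp(−ℰ_t(x)) = ∫ p_{0t}(x0|x)·p_c(x0)^β dx0, and the score of q_t(x) := p_t(x)·exp(−ℰ_t(x))/Z satisfies ∇_x log q_t(x) = ∇_x log p_t(x) + ∇_x log ∫ p_{0t}(x0|x)·p_c(x0)^β dx0. -/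
open MeasureTheory Set

/-- With classifier energy `ℰ(x0) := −log p_c(x0)`, one has
`exp(−ℰ_t(x)) = ∫ p_{0t}(x0|x) · p_c(x0)^β dx0`, and the score of
`q_t(x) := p_t(x)·exp(−ℰ_t(x))/Z` decomposes as
`∇ log q_t(x) = ∇ log p_t(x) + ∇ log ∫ p_{0t}(x0|x)·p_c(x0)^β dx0`. -/
theorem classifier_energy_score_decomposition
    (d : ℕ) (hd : 1 ≤ d)
    (p0 : EuclideanSpace ℝ (Fin d) → ℝ)
    (pc : EuclideanSpace ℝ (Fin d) → ℝ)
    (hpc_pos : ∀ x, 0 < pc x) (hpc_le : ∀ x, pc x ≤ 1) (hpc_meas : Measurable pc)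
    (En : EuclideanSpace ℝ (Fin d) → ℝ)
    (hEn_def : ∀ x, En x = -Real.log (pc x))
    (β : ℝ) (hβ : 0 < β)
    (pt0 : ℝ → EuclideanSpace ℝ (Fin d) → EuclideanSpace ℝ (Fin d) → ℝ)
    (hp0_nonneg : ∀ x, 0 ≤ p0 x)
    (hp0_meas : Measurable p0)
    (hp0_int : ∫ x, p0 x = 1)
    (hpt0_nonneg : ∀ t ∈ Icc (0:ℝ) 1, ∀ x0 x, 0 ≤ pt0 t x0 x)
    (hpt0_meas : ∀ t ∈ Icc (0:ℝ) 1,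
      Measurable (fun q : EuclideanSpace ℝ (Fin d) × EuclideanSpace ℝ (Fin d) => pt0 t q.1 q.2))
    (hpt0_int : ∀ t ∈ Icc (0:ℝ) 1, ∀ x0, ∫ x, pt0 t x0 x = 1)
    (Z : ℝ)
    (hZ_def : Z = ∫ x0, p0 x0 * Real.exp (-β * En x0))
    (hZ_int : Integrable (fun x0 => p0 x0 * Real.exp (-β * En x0)))
    (hZ_pos : 0 < Z)
    (pt : ℝ → EuclideanSpace ℝ (Fin d) → ℝ)
    (hpt_def : ∀ t x, pt t x = ∫ x0, pt0 t x0 x * p0 x0)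
    (hpt_pos : ∀ t ∈ Icc (0:ℝ) 1, ∀ x, 0 < pt t x)
    (p0t : ℝ → EuclideanSpace ℝ (Fin d) → EuclideanSpace ℝ (Fin d) → ℝ)
    (hp0t_def : ∀ t x0 x, p0t t x0 x = pt0 t x0 x * p0 x0 / pt t x)
    (Et : ℝ → EuclideanSpace ℝ (Fin d) → ℝ)
    (hEt_def : ∀ t ∈ Icc (0:ℝ) 1, ∀ x,
      Real.exp (-(Et t x)) = ∫ x0, p0t t x0 x * Real.exp (-β * En x0))
    (hEt_int : ∀ t ∈ Icc (0:ℝ) 1, ∀ x,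
      Integrable (fun x0 => p0t t x0 x * Real.exp (-β * En x0)))
    -- fix `t` and `x`, with the stated differentiability assumptions
    (t : ℝ) (ht : t ∈ Icc (0:ℝ) 1)
    (x : EuclideanSpace ℝ (Fin d))
    (hpt_diff : DifferentiableAt ℝ (fun y => pt t y) x)
    (hG_diff : DifferentiableAt ℝ (fun y => ∫ x0, pt0 t x0 y * (p0 x0 * pc x0 ^ β)) x) :
    Real.exp (-(Et t x)) = (∫ x0, p0t t x0 x * pc x0 ^ β) ∧
    DifferentiableAt ℝ (fun y => ∫ x0, p0t t x0 y * pc x0 ^ β) x ∧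
    DifferentiableAt ℝ (fun y => pt t y * Real.exp (-(Et t y)) / Z) x ∧
    (pt t x * Real.exp (-(Et t x)) / Z)⁻¹ •
        gradient (fun y => pt t y * Real.exp (-(Et t y)) / Z) x =
      (pt t x)⁻¹ • gradient (fun y => pt t y) x +
      (∫ x0, p0t t x0 x * pc x0 ^ β)⁻¹ •
        gradient (fun y => ∫ x0, p0t t x0 y * pc x0 ^ β) x := by
  have hexp : ∀ x0, Real.exp (-β * En x0) = pc x0 ^ β := by
    intro x0
    rw [hEn_def, Real.rpow_def_of_pos (hpc_pos x0)]
    congr 1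
    ring
  have hE : ∀ y, Real.exp (-(Et t y)) = ∫ x0, p0t t x0 y * pc x0 ^ β := by
    intro y
    rw [hEt_def t ht y]
    simp only [hexp]
  have hH : ∀ y, (∫ x0, p0t t x0 y * pc x0 ^ β)
      = (∫ x0, pt0 t x0 y * (p0 x0 * pc x0 ^ β)) * (pt t y)⁻¹ := by
    intro y
    rw [← integral_mul_const]
    congr 1
    funext x0
    rw [hp0t_def]
    ring
  have hptx : pt t x ≠ 0 := (hpt_pos t ht x).ne'
  have hHd : DifferentiableAt ℝ (fun y => ∫ x0, p0t t x0 y * pc x0 ^ β) x := by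
    simp only [hH]
    exact hG_diff.mul (hpt_diff.inv hptx)
  have hHpos : (∫ x0, p0t t x0 x * pc x0 ^ β) ≠ 0 := by
    rw [← hE]
    exact (Real.exp_pos _).ne'
  refine ⟨hE x, hHd, ?_, ?_⟩
  · simp only [hE]
    simp only [div_eq_mul_inv]
    exact (hpt_diff.mul hHd).mul_const Z⁻¹
  · simp only [hE]
    have hd := ((hpt_diff.hasFDerivAt.mul hHd.hasFDerivAt).mul_const Z⁻¹).fderiv
    simp only [gradient, div_eq_mul_inv]
    erw [hd]
    simp only [map_add, map_smul, smul_add, smul_smul]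
    rw [add_comm]
    congr 2 <;> field_simp
end

section
/- Take β = 1 and ℰ(x0) := −log p_c(x0) for a measurable classifier likelihood p_c : ℝ^d → (0,1], and set p(c) := ∫ p_0(x0)·p_c(x0) dx0 ∈ (0,∞). Define the class-conditional data density p_0^c(x0) := p_c(x0)·p_0(x0)/p(c) and its time-t marginal p_t^c(x) := ∫ p_{t0}(x|x0)·p_0^c(x0) dx0, assumed positive and differentiable in x with ∇_x p_t^c(x) = ∫ ∇_x p_{t0}(x|x0)·p_0^c(x0) dx0 (differentiation under the integral sign), under the Gaussian path. Let λ : [0,1] → [0,∞) be a probability density over time, and for measurable s : [0,1] × ℝ^d → ℝ^d define L_CED(s) := ∫_0^1 ∫∫ λ(t)·p_0(x0)·p_{t0}(x|x0)·(p_c(x0)/p(c))·‖s(t,x) − ∇_x log p_{t0}(x|x0)‖² dx0 dx dt, where ∇_x log p_{t0}(x|x0) = −(x − μ_t x0)/σ_t². Assume ∫_0^1 ∫∫ λ(t)·p_0^c(x0)·p_{t0}(x|x0)·‖∇_x log p_{t0}(x|x0)‖² dx0 dx dt < ∞. Then s*(t,x) := ∇_x log p_t^c(x) is a global minimizer: for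 every measurable s with L_CED(s) < ∞, L_CED(s*) ≤ L_CED(s). -/
open MeasureTheory Set

theorem aux_var {E : Type*} [NormedAddCommGroup E] [InnerProductSpace ℝ E] [CompleteSpace E]
    {α : Type*} [MeasurableSpace α] {ν : Measure α}
    (w : α → ℝ) (g : α → E) (hw : ∀ x, 0 ≤ w x) (hwi : Integrable w ν)
    (hg : AEStronglyMeasurable g ν) (a m : E)
    (hi : Integrable (fun x => w x * ‖a + g x‖ ^ 2) ν)
    (hm : (∫ x, w x ∂ν) • m + ∫ x, w x • g x ∂ν = 0) :
    ∫ x, w x * ‖m + g x‖ ^ 2 ∂ν ≤ ∫ x, w x * ‖a + g x‖ ^ 2 ∂ν := by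
  have h1 : Integrable (fun x => w x • (a + g x)) ν := by
    refine (hwi.add hi).mono (hwi.aestronglyMeasurable.smul
      (aestronglyMeasurable_const.add hg)) (Filter.Eventually.of_forall fun x => ?_)
    simp only [Pi.add_apply]
    rw [norm_smul, Real.norm_of_nonneg (hw x), Real.norm_of_nonneg
      (add_nonneg (hw x) (mul_nonneg (hw x) (sq_nonneg _)))]
    nlinarith [mul_nonneg (hw x) (sq_nonneg (‖a + g x‖ - 1)),
      mul_nonneg (hw x) (sq_nonneg (‖a + g x‖)), hw x]
  have h2 : Integrable (fun x => w x • g x) ν := by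
    have := h1.sub (hwi.smul_const a)
    refine this.congr (Filter.Eventually.of_forall fun x => ?_)
    simp [smul_add]
  have h3 : Integrable (fun x => w x • (m + g x)) ν := by
    have := (hwi.smul_const m).add h2
    refine this.congr (Filter.Eventually.of_forall fun x => ?_)
    simp [smul_add]
  have h4 : ∫ x, w x • (m + g x) ∂ν = 0 := by
    simp_rw [smul_add]
    rw [integral_add (hwi.smul_const m) h2, integral_smul_const, hm]
  have h5 : ∀ x, w x * ‖m + g x‖ ^ 2 = w x * ‖a + g x‖ ^ 2 -
      (w x * ‖a - m‖ ^ 2 + 2 * inner ℝ (a - m) (w x • (m + g x))) := by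
    intro x
    have : a + g x = (a - m) + (m + g x) := by abel
    rw [this, norm_add_sq_real (a - m) (m + g x), inner_smul_right]
    ring
  have h6 : Integrable (fun x => 2 * inner ℝ (a - m) (w x • (m + g x))) ν :=
    (h3.const_inner (𝕜 := ℝ) (a - m)).const_mul 2
  have h7 : Integrable (fun x => w x * ‖a - m‖ ^ 2) ν := hwi.mul_const _
  have h8 : Integrable (fun x => w x * ‖a - m‖ ^ 2 + 2 * inner ℝ (a - m) (w x • (m + g x))) ν :=
    h7.add h6
  simp_rw [h5]
  rw [integral_sub hi h8, integral_add h7 h6, integral_const_mul,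
    integral_inner h3, h4, inner_zero_right, integral_mul_const]
  have : 0 ≤ ∫ x, w x ∂ν := integral_nonneg hw
  nlinarith [mul_nonneg this (sq_nonneg ‖a - m‖)]

theorem aux_grad {E : Type*} [NormedAddCommGroup E] [InnerProductSpace ℝ E] [CompleteSpace E]
    (C r : ℝ) (hr : 0 < r) (z x : E) :
    gradient (fun y => C * Real.exp (-‖y - z‖ ^ 2 / (2 * r))) x =
      -((C * Real.exp (-‖x - z‖ ^ 2 / (2 * r))) • (r⁻¹ • (x - z))) := by
  apply HasGradientAt.gradient
  rw [hasGradientAt_iff_hasFDerivAt]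
  have h := ((((hasFDerivAt_id (𝕜 := ℝ) x).sub_const z).norm_sq.neg.mul_const
    ((2 * r)⁻¹)).exp).const_mul C
  simp only [← div_eq_mul_inv, id] at h
  refine h.congr_fderiv ?_
  ext v
  simp
  field_simp

/-- With `β = 1` and `ℰ = −log p_c`, the class-conditional score
`s*(t,x) := ∇ log p_t^c(x)` is a global minimizer of the conditional energy-weighted
diffusion loss `L_CED`. -/
theorem classifier_free_global_minimizer
    (d : ℕ) (hd : 1 ≤ d)
    (p0 : EuclideanSpace ℝ (Fin d) → ℝ)
    (pc : EuclideanSpace ℝ (Fin d) → ℝ)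
    (hpc_pos : ∀ x, 0 < pc x) (hpc_le : ∀ x, pc x ≤ 1) (hpc_meas : Measurable pc)
    (μ σ : ℝ → ℝ) (hσ : ∀ t, 0 < σ t)
    (pt0 : ℝ → EuclideanSpace ℝ (Fin d) → EuclideanSpace ℝ (Fin d) → ℝ)
    (hpt0_def : ∀ t x0 y, pt0 t x0 y =
      (2 * Real.pi * σ t ^ 2) ^ (-(d : ℝ) / 2) *
        Real.exp (-‖y - μ t • x0‖ ^ 2 / (2 * σ t ^ 2)))
    (hp0_nonneg : ∀ x, 0 ≤ p0 x)
    (hp0_meas : Measurable p0)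
    (hp0_int : ∫ x, p0 x = 1)
    -- `p(c) := ∫ p_0 · p_c ∈ (0, ∞)`
    (pcC : ℝ)
    (hpcC_def : pcC = ∫ x0, p0 x0 * pc x0)
    (hpcC_int : Integrable (fun x0 => p0 x0 * pc x0))
    (hpcC_pos : 0 < pcC)
    -- the class-conditional data density and its time-`t` marginal
    (p0c : EuclideanSpace ℝ (Fin d) → ℝ)
    (hp0c_def : ∀ x0, p0c x0 = pc x0 * p0 x0 / pcC)
    (ptc : ℝ → EuclideanSpace ℝ (Fin d) → ℝ)
    (hptc_def : ∀ t x, ptc t x = ∫ x0, pt0 t x0 x * p0c x0)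
    (hptc_pos : ∀ t ∈ Icc (0:ℝ) 1, ∀ x, 0 < ptc t x)
    -- differentiability with differentiation under the integral sign
    (hptc_DUI : ∀ t ∈ Icc (0:ℝ) 1, ∀ x,
      HasGradientAt (fun y => ptc t y)
        (∫ x0, p0c x0 • gradient (fun y => pt0 t x0 y) x) x)
    -- `λ` is a probability density over time
    (lam : ℝ → ℝ)
    (hlam_nonneg : ∀ t, 0 ≤ lam t)
    (hlam_int : ∫ t in Icc (0:ℝ) 1, lam t = 1)
    -- finiteness of the weighted second moment of the conditional scores
    (hmom : Integrable
      (fun q : ℝ × EuclideanSpace ℝ (Fin d) × EuclideanSpace ℝ (Fin d) =>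
        lam q.1 * p0c q.2.2 * pt0 q.1 q.2.2 q.2.1 *
          ‖(σ q.1 ^ 2)⁻¹ • (q.2.1 - μ q.1 • q.2.2)‖ ^ 2)
      ((volume.restrict (Icc (0:ℝ) 1)).prod (volume.prod volume))) :
    ∀ s : ℝ → EuclideanSpace ℝ (Fin d) → EuclideanSpace ℝ (Fin d),
      Measurable (fun q : ℝ × EuclideanSpace ℝ (Fin d) => s q.1 q.2) →
      Integrable
        (fun q : ℝ × EuclideanSpace ℝ (Fin d) × EuclideanSpace ℝ (Fin d) =>
          lam q.1 * p0 q.2.2 * pt0 q.1 q.2.2 q.2.1 * (pc q.2.2 / pcC) *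
            ‖s q.1 q.2.1 + (σ q.1 ^ 2)⁻¹ • (q.2.1 - μ q.1 • q.2.2)‖ ^ 2)
        ((volume.restrict (Icc (0:ℝ) 1)).prod (volume.prod volume)) →
      (∫ t in Icc (0:ℝ) 1, ∫ x, ∫ x0,
          lam t * p0 x0 * pt0 t x0 x * (pc x0 / pcC) *
            ‖(ptc t x)⁻¹ • gradient (fun y => ptc t y) x +
              (σ t ^ 2)⁻¹ • (x - μ t • x0)‖ ^ 2) ≤
      (∫ t in Icc (0:ℝ) 1, ∫ x, ∫ x0,
          lam t * p0 x0 * pt0 t x0 x * (pc x0 / pcC) *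
            ‖s t x + (σ t ^ 2)⁻¹ • (x - μ t • x0)‖ ^ 2) := by
  intro s hs hLint
  have hpt_nonneg : ∀ t x0 y, 0 ≤ pt0 t x0 y := by
    intro t x0 y
    rw [hpt0_def]
    have := hσ t
    positivity
  have hw0 : ∀ t x x0, 0 ≤ lam t * p0 x0 * pt0 t x0 x * (pc x0 / pcC) := by
    intro t x x0
    exact mul_nonneg (mul_nonneg (mul_nonneg (hlam_nonneg t) (hp0_nonneg x0)) (hpt_nonneg _ _ _))
      (div_nonneg (hpc_pos x0).le hpcC_pos.le)
  have key : ∀ t ∈ Icc (0:ℝ) 1, ∀ x, Integrable (fun x0 =>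
      lam t * p0 x0 * pt0 t x0 x * (pc x0 / pcC) *
            ‖s t x + (σ t ^ 2)⁻¹ • (x - μ t • x0)‖ ^ 2) →
      (∫ x0, lam t * p0 x0 * pt0 t x0 x * (pc x0 / pcC) *
            ‖(ptc t x)⁻¹ • gradient (fun y => ptc t y) x +
              (σ t ^ 2)⁻¹ • (x - μ t • x0)‖ ^ 2) ≤
      ∫ x0, lam t * p0 x0 * pt0 t x0 x * (pc x0 / pcC) *
            ‖s t x + (σ t ^ 2)⁻¹ • (x - μ t • x0)‖ ^ 2 := by
    intro t ht x hi
    have hpos := hptc_pos t ht x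
    have hI : Integrable (fun x0 => pt0 t x0 x * p0c x0) := by
      by_contra hc
      rw [hptc_def, integral_undef hc] at hpos
      exact lt_irrefl _ hpos
    have hweq : (fun x0 => lam t * p0 x0 * pt0 t x0 x * (pc x0 / pcC)) =
        fun x0 => lam t * (pt0 t x0 x * p0c x0) := by
      funext x0
      rw [hp0c_def]
      ring
    refine aux_var (fun x0 => lam t * p0 x0 * pt0 t x0 x * (pc x0 / pcC))
      (fun x0 => (σ t ^ 2)⁻¹ • (x - μ t • x0)) (hw0 t x) ?_ ?_ _ _ hi ?_
    · rw [hweq]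
      exact hI.const_mul _
    · exact (by fun_prop : Continuous (fun x0 : EuclideanSpace ℝ (Fin d) => (σ t ^ 2)⁻¹ • (x - μ t • x0))).aestronglyMeasurable
    · have e1 : ∀ x0, p0c x0 • gradient (fun y => pt0 t x0 y) x =
          -((pt0 t x0 x * p0c x0) • ((σ t ^ 2)⁻¹ • (x - μ t • x0))) := by
        intro x0
        simp_rw [hpt0_def]
        rw [aux_grad _ _ (pow_pos (hσ t) 2), smul_neg, smul_smul, mul_comm (p0c x0)]
      have e2 : ∀ x0, (lam t * p0 x0 * pt0 t x0 x * (pc x0 / pcC)) •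
          ((σ t ^ 2)⁻¹ • (x - μ t • x0)) =
          lam t • ((pt0 t x0 x * p0c x0) • ((σ t ^ 2)⁻¹ • (x - μ t • x0))) := by
        intro x0
        rw [congrFun hweq x0, mul_smul (lam t)]
      rw [(hptc_DUI t ht x).gradient]
      simp_rw [e1, e2]
      rw [hweq, integral_const_mul, ← hptc_def, integral_neg, integral_smul, smul_smul,
        mul_assoc, mul_inv_cancel₀ hpos.ne', mul_one, smul_neg, neg_add_cancel]
  have h0 : ∀ t x (v : EuclideanSpace ℝ (Fin d)), 0 ≤ ∫ x0, lam t * p0 x0 * pt0 t x0 x * (pc x0 / pcC) *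
            ‖v + (σ t ^ 2)⁻¹ • (x - μ t • x0)‖ ^ 2 := fun t x v =>
    integral_nonneg fun x0 => mul_nonneg (hw0 t x x0) (sq_nonneg _)
  refine integral_mono_of_nonneg (Filter.Eventually.of_forall fun t =>
    integral_nonneg fun x => h0 t x _) ?_ ?_
  · refine hLint.integral_prod_left.congr ?_
    filter_upwards [hLint.prod_right_ae] with t ht
    exact integral_prod _ ht
  · filter_upwards [hLint.prod_right_ae, ae_restrict_mem measurableSet_Icc] with t ht htI
    refine integral_mono_of_nonneg (Filter.Eventually.of_forall fun x => h0 t x _)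
      ht.integral_prod_left ?_
    filter_upwards [ht.prod_right_ae] with x hx
    exact key t htI x hx
end

section
/- Under the Gaussian path, fix t ∈ (0,1] and x ∈ ℝ^d, and assume p_t is positive and differentiable at x, the function x ↦ ∫ p_{t0}(x|x0)·p_0(x0)·exp(−β ℰ(x0)) dx0 is differentiable at x with gradient obtained by differentiating under the integral sign, and ℰ_t is differentiable at x. Then the gradient of the intermediate energy admits the representation ∇_x ℰ_t(x) = exp(ℰ_t(x)) · ∫ p_{0t}(x0|x)·exp(−β ℰ(x0))·( ∇_x log p_t(x) − ∇_x log p_{t0}(x|x0) ) dx0, where ∇_x log p_{t0}(x|x0) = −(x − μ_t x0)/σ_t². -/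
open MeasureTheory Set

theorem aux_bound (s u : ℝ) (hs : 0 < s) :
    Real.exp (-u ^ 2 / (2 * s ^ 2)) * u ≤ s := by
  have h1 := Real.add_one_le_exp (u ^ 2 / (2 * s ^ 2))
  have h2 : u ≤ s * (u ^ 2 / (2 * s ^ 2) + 1) := by
    have : s * (u ^ 2 / (2 * s ^ 2) + 1) - u = (s ^ 2 + (u - s) ^ 2) / (2 * s) := by
      field_simp
      ring
    have h3 : 0 ≤ (s ^ 2 + (u - s) ^ 2) / (2 * s) := by positivity
    linarith
  have h4 : u ≤ s * Real.exp (u ^ 2 / (2 * s ^ 2)) :=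
    h2.trans (mul_le_mul_of_nonneg_left h1 hs.le)
  have h5 : Real.exp (-u ^ 2 / (2 * s ^ 2)) * Real.exp (u ^ 2 / (2 * s ^ 2)) = 1 := by
    rw [← Real.exp_add]
    ring_nf
    exact Real.exp_zero
  calc _ ≤ Real.exp (-u ^ 2 / (2 * s ^ 2)) * (s * Real.exp (u ^ 2 / (2 * s ^ 2))) :=
        mul_le_mul_of_nonneg_left h4 (Real.exp_pos _).le
    _ = s * (Real.exp (-u ^ 2 / (2 * s ^ 2)) * Real.exp (u ^ 2 / (2 * s ^ 2))) := by ring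
    _ = s := by rw [h5, mul_one]

theorem aux_grad_s11 {d : ℕ} (c s : ℝ) (hs : 0 < s) (a x : EuclideanSpace ℝ (Fin d)) :
    HasGradientAt (fun y => c * Real.exp (-‖y - a‖ ^ 2 / (2 * s ^ 2)))
      (-((c * Real.exp (-‖x - a‖ ^ 2 / (2 * s ^ 2))) • ((s ^ 2)⁻¹ • (x - a)))) x := by
  rw [hasGradientAt_iff_hasFDerivAt]
  have h1 := ((((hasFDerivAt_id (𝕜 := ℝ) x).sub_const a).norm_sq.neg.mul_const
    ((2 * s ^ 2)⁻¹)).exp).const_mul c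
  simp only [← div_eq_mul_inv, id] at h1
  refine h1.congr_fderiv ?_
  ext v
  simp
  field_simp

/-- Under the Gaussian path, the gradient of the intermediate energy
admits the representation
`∇ℰ_t(x) = e^{ℰ_t(x)} ∫ p_{0t}(x0|x) e^{−βℰ(x0)} (∇ log p_t(x) − ∇ log p_{t0}(x|x0)) dx0`,
where `∇ log p_{t0}(x|x0) = −(x − μ_t x0)/σ_t²`. -/
theorem intermediate_energy_gradient_representation
    (d : ℕ) (hd : 1 ≤ d)
    (p0 : EuclideanSpace ℝ (Fin d) → ℝ)
    (En : EuclideanSpace ℝ (Fin d) → ℝ)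
    (β : ℝ) (hβ : 0 < β)
    (μ σ : ℝ → ℝ) (hσ : ∀ t, 0 < σ t)
    (pt0 : ℝ → EuclideanSpace ℝ (Fin d) → EuclideanSpace ℝ (Fin d) → ℝ)
    (hpt0_def : ∀ t x0 y, pt0 t x0 y =
      (2 * Real.pi * σ t ^ 2) ^ (-(d : ℝ) / 2) *
        Real.exp (-‖y - μ t • x0‖ ^ 2 / (2 * σ t ^ 2)))
    (hp0_nonneg : ∀ x, 0 ≤ p0 x)
    (hp0_meas : Measurable p0)
    (hp0_int : ∫ x, p0 x = 1)
    (hEn_meas : Measurable En)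
    (Z : ℝ)
    (hZ_def : Z = ∫ x0, p0 x0 * Real.exp (-β * En x0))
    (hZ_int : Integrable (fun x0 => p0 x0 * Real.exp (-β * En x0)))
    (hZ_pos : 0 < Z)
    (pt : ℝ → EuclideanSpace ℝ (Fin d) → ℝ)
    (hpt_def : ∀ t x, pt t x = ∫ x0, pt0 t x0 x * p0 x0)
    (hpt_pos : ∀ t ∈ Icc (0:ℝ) 1, ∀ x, 0 < pt t x)
    (p0t : ℝ → EuclideanSpace ℝ (Fin d) → EuclideanSpace ℝ (Fin d) → ℝ)
    (hp0t_def : ∀ t x0 x, p0t t x0 x = pt0 t x0 x * p0 x0 / pt t x)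
    (Et : ℝ → EuclideanSpace ℝ (Fin d) → ℝ)
    (hEt_def : ∀ t ∈ Icc (0:ℝ) 1, ∀ x,
      Real.exp (-(Et t x)) = ∫ x0, p0t t x0 x * Real.exp (-β * En x0))
    (hEt_int : ∀ t ∈ Icc (0:ℝ) 1, ∀ x,
      Integrable (fun x0 => p0t t x0 x * Real.exp (-β * En x0)))
    -- fix `t ∈ (0,1]` and `x`, with the stated differentiability assumptions
    (t : ℝ) (ht : t ∈ Ioc (0:ℝ) 1)
    (x : EuclideanSpace ℝ (Fin d))
    (hpt_diff : DifferentiableAt ℝ (fun y => pt t y) x)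
    (hDUI : HasGradientAt
      (fun y => ∫ x0, pt0 t x0 y * (p0 x0 * Real.exp (-β * En x0)))
      (∫ x0, (p0 x0 * Real.exp (-β * En x0)) • gradient (fun y => pt0 t x0 y) x) x)
    (hEt_diff : DifferentiableAt ℝ (fun y => Et t y) x) :
    gradient (fun y => Et t y) x =
      Real.exp (Et t x) •
        ∫ x0, (p0t t x0 x * Real.exp (-β * En x0)) •
          ((pt t x)⁻¹ • gradient (fun y => pt t y) x -
            (-((σ t ^ 2)⁻¹ • (x - μ t • x0)))) := by
  have ht' : t ∈ Icc (0:ℝ) 1 := ⟨ht.1.le, ht.2⟩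
  have hs := hσ t
  set w : EuclideanSpace ℝ (Fin d) → ℝ := fun x0 => p0 x0 * Real.exp (-β * En x0) with hw
  set A : EuclideanSpace ℝ (Fin d) → ℝ := fun y => ∫ x0, pt0 t x0 y * w x0 with hA
  have hg : ∀ x0, gradient (fun y => pt0 t x0 y) x
      = -(pt0 t x0 x • ((σ t ^ 2)⁻¹ • (x - μ t • x0))) := by
    intro x0
    simp only [hpt0_def]
    exact (aux_grad_s11 _ (σ t) hs (μ t • x0) x).gradient
  have hq : ∀ y x0, p0t t x0 y * Real.exp (-β * En x0) = (pt t y)⁻¹ * (pt0 t x0 y * w x0) := by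
    intro y x0
    rw [hp0t_def]
    simp only [hw]
    ring
  have hAe : ∀ y, Real.exp (-(Et t y)) = (pt t y)⁻¹ * A y := by
    intro y
    rw [hEt_def t ht' y]
    simp only [hq, integral_const_mul, hA]
  have hApos : ∀ y, 0 < A y := by
    intro y
    have h := Real.exp_pos (-(Et t y))
    rw [hAe] at h
    exact (pos_iff_pos_of_mul_pos h).1 (inv_pos.2 (hpt_pos t ht' y))
  have hEt : (fun y => Et t y) = fun y => Real.log (pt t y) - Real.log (A y) := by
    funext y
    have h := congrArg Real.log (hAe y)
    rw [Real.log_exp, Real.log_mul (inv_ne_zero (hpt_pos t ht' y).ne') (hApos y).ne',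
      Real.log_inv] at h
    linarith
  have hexp : Real.exp (Et t x) = pt t x * (A x)⁻¹ := by
    have h := hAe x
    rw [Real.exp_neg] at h
    rw [← inv_inv (Real.exp (Et t x)), h, mul_inv, inv_inv]
  -- the gradient of the energy
  have hG : gradient (fun y => Et t y) x =
      (pt t x)⁻¹ • gradient (fun y => pt t y) x
        - (A x)⁻¹ • ∫ x0, w x0 • gradient (fun y => pt0 t x0 y) x := by
    rw [hEt]
    apply HasGradientAt.gradient
    have h1 := hpt_diff.hasGradientAt.hasFDerivAt.log (hpt_pos t ht' x).ne'
    have h2 := (hasGradientAt_iff_hasFDerivAt.1 hDUI).log (hApos x).ne'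
    rw [hasGradientAt_iff_hasFDerivAt]
    refine (h1.sub h2).congr_fderiv ?_
    simp only [map_sub, map_smulₛₗ]
    rfl
  have hI0 : Integrable (fun x0 => pt0 t x0 x * w x0) := by
    have h := (hEt_int t ht' x).const_mul (pt t x)
    refine h.congr (ae_of_all _ fun x0 => ?_)
    simp only [hq]
    rw [mul_inv_cancel_left₀ (hpt_pos t ht' x).ne']
  have hI1 : Integrable (fun x0 => (pt0 t x0 x * w x0) • ((σ t ^ 2)⁻¹ • (x - μ t • x0))) := by
    have hc : Continuous (fun x0 => pt0 t x0 x • ((σ t ^ 2)⁻¹ • (x - μ t • x0))) := by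
      simp only [hpt0_def]
      fun_prop
    have hcp : 0 ≤ (2 * Real.pi * σ t ^ 2) ^ (-(d : ℝ) / 2) := by positivity
    have h := hZ_int.smul_bdd (C := (σ t ^ 2)⁻¹ *
      ((2 * Real.pi * σ t ^ 2) ^ (-(d : ℝ) / 2) * σ t)) hc.aestronglyMeasurable
      (ae_of_all _ fun x0 => ?_)
    · refine h.congr (ae_of_all _ fun x0 => ?_)
      simp only [Pi.smul_apply', smul_smul, hw]
      congr 1
      ring
    · rw [norm_smul, norm_smul, hpt0_def, Real.norm_of_nonneg (by positivity),
        Real.norm_of_nonneg (by positivity)]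
      have := aux_bound (σ t) ‖x - μ t • x0‖ hs
      calc _ = (σ t ^ 2)⁻¹ * ((2 * Real.pi * σ t ^ 2) ^ (-(d : ℝ) / 2) *
            (Real.exp (-‖x - μ t • x0‖ ^ 2 / (2 * σ t ^ 2)) * ‖x - μ t • x0‖)) := by ring
        _ ≤ _ := by gcongr
  have hgi : ∫ x0, w x0 • gradient (fun y => pt0 t x0 y) x
      = -∫ x0, (pt0 t x0 x * w x0) • ((σ t ^ 2)⁻¹ • (x - μ t • x0)) := by
    rw [← integral_neg]
    congr 1
    funext x0
    rw [hg, smul_neg, smul_smul, mul_comm]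
  rw [hG, hgi, hexp]
  simp only [hq, mul_smul (pt t x)⁻¹, sub_neg_eq_add, smul_add (pt0 t _ x * w _)]
  rw [integral_smul, integral_add (hI0.smul_const _) hI1, integral_smul_const]
  change _ = _ • _ • (A x • _ + _)
  have hp := (hpt_pos t ht' x).ne'
  have ha := (hApos x).ne'
  rw [smul_smul, show pt t x * (A x)⁻¹ * (pt t x)⁻¹ = (A x)⁻¹ by field_simp, smul_add,
    smul_smul (A x)⁻¹ (A x), inv_mul_cancel₀ ha, one_smul, smul_neg, sub_neg_eq_add]
end

section
/- Let λ : [0,1] → [0,∞) be a probability density over time and define the marginal vector field u_t(x) := ∫ p_{0t}(x0|x)·u_{t0}(x|x0) dx0. For a measurable b : [0,1] × ℝ^d → ℝ^d define the flow matching loss L_FM(b) := ∫_0^1 ∫ λ(t)·p_t(x)·‖b(t,x) − u_t(x)‖² dx dt and the conditional flow matching loss L_CFM(b) := ∫_0^1 ∫∫ λ(t)·p_0(x0)·p_{t0}(x|x0)·‖b(t,x) − u_{t0}(x|x0)‖² dx0 dx dt. Assume ∫_0^1 ∫ λ(t)·p_t(x)·‖u_t(x)‖² dx dt and ∫_0^1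 ∫∫ λ(t)·p_0(x0)·p_{t0}(x|x0)·‖u_{t0}(x|x0)‖² dx0 dx dt are finite. Then there exists a constant C ∈ ℝ, independent of b, such that for every b for which all the integrals converge absolutely, L_FM(b) = L_CFM(b) + C; explicitly, C = ∫_0^1 ∫ λ(t)·p_t(x)·‖u_t(x)‖² dx dt − ∫_0^1 ∫∫ λ(t)·p_0(x0)·p_{t0}(x|x0)·‖u_{t0}(x|x0)‖² dx0 dx dt. -/
open MeasureTheory Set

theorem fm_aux_integral {E : Type*} [MeasureSpace E] [SFinite (volume : Measure E)]
    (μ : Measure ℝ) [SFinite μ]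
    (f1 f2 : ℝ → E → ℝ) (g1 g2 : ℝ → E → E → ℝ)
    (hf1 : Integrable (fun q : ℝ × E => f1 q.1 q.2) (μ.prod volume))
    (hf2 : Integrable (fun q : ℝ × E => f2 q.1 q.2) (μ.prod volume))
    (hg1 : Integrable (fun q : ℝ × E × E => g1 q.1 q.2.1 q.2.2) (μ.prod (volume.prod volume)))
    (hg2 : Integrable (fun q : ℝ × E × E => g2 q.1 q.2.1 q.2.2) (μ.prod (volume.prod volume)))
    (h : ∀ᵐ t ∂μ, ∀ᵐ x, f1 t x = (∫ x0, g1 t x x0) + (f2 t x - ∫ x0, g2 t x x0)) :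
    (∫ t, (∫ x, f1 t x) ∂μ) = (∫ t, (∫ x, ∫ x0, g1 t x x0) ∂μ) +
      ((∫ t, (∫ x, f2 t x) ∂μ) - ∫ t, (∫ x, ∫ x0, g2 t x x0) ∂μ) := by
  have key : ∀ g : ℝ → E → E → ℝ,
      Integrable (fun q : ℝ × E × E => g q.1 q.2.1 q.2.2) (μ.prod (volume.prod volume)) →
      Integrable (fun t => ∫ x, ∫ x0, g t x x0) μ := by
    intro g hg
    refine hg.integral_prod_left.congr ?_
    filter_upwards [hg.prod_right_ae] with t ht
    exact integral_prod _ ht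
  have hF2 : Integrable (fun t => ∫ x, f2 t x) μ := hf2.integral_prod_left
  have hS : Integrable (fun t => (∫ x, f2 t x) - ∫ x, ∫ x0, g2 t x x0) μ :=
    hF2.sub (key g2 hg2)
  rw [← integral_sub hF2 (key g2 hg2), ← integral_add (key g1 hg1) hS]
  refine integral_congr_ae ?_
  filter_upwards [h, hg1.prod_right_ae, hg2.prod_right_ae, hf2.prod_right_ae] with t ht h1 h2 h3
  have h1' : Integrable (fun x => ∫ x0, g1 t x x0) := h1.integral_prod_left
  have h2' : Integrable (fun x => ∫ x0, g2 t x x0) := h2.integral_prod_left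
  have h3' : Integrable (fun x => f2 t x) := h3
  have h4 : Integrable (fun x => f2 t x - ∫ x0, g2 t x x0) := h3'.sub h2'
  rw [integral_congr_ae ht, integral_add h1' h4, integral_sub h3' h2']

theorem fm_aux_pointwise {d : ℕ} (l P : ℝ) (hl : 0 ≤ l)
    (w : EuclideanSpace ℝ (Fin d) → ℝ) (hw : ∀ y, 0 ≤ w y) (hwm : Measurable w)
    (hP : P = ∫ y, w y) (hPpos : 0 < P)
    (v : EuclideanSpace ℝ (Fin d) → EuclideanSpace ℝ (Fin d)) (hv : Measurable v)
    (m b : EuclideanSpace ℝ (Fin d)) (hm : m = ∫ y, (w y / P) • v y)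
    (hint : Integrable (fun y => l * (w y * ‖v y‖ ^ 2))) :
    l * P * ‖b - m‖ ^ 2 = (∫ y, l * (w y * ‖b - v y‖ ^ 2)) +
      (l * P * ‖m‖ ^ 2 - ∫ y, l * (w y * ‖v y‖ ^ 2)) := by
  rcases hl.eq_or_lt with rfl | hl
  · simp
  have hwi : Integrable w := by
    by_contra hc
    rw [integral_undef hc] at hP
    exact hPpos.ne' hP
  have h2 : Integrable (fun y => w y * ‖v y‖ ^ 2) := by
    have := hint.const_mul l⁻¹
    refine this.congr (Filter.Eventually.of_forall fun y => ?_)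
    simp only
    field_simp
  have h1 : Integrable (fun y => w y • v y) := by
    refine (hwi.add h2).mono' (hwm.smul hv).aestronglyMeasurable
      (Filter.Eventually.of_forall fun y => ?_)
    rw [norm_smul, Real.norm_of_nonneg (hw y)]
    simp only [Pi.add_apply]
    nlinarith [hw y, mul_nonneg (hw y) (sq_nonneg (‖v y‖ - 1)), mul_nonneg (hw y) (sq_nonneg (‖v y‖))]
  have hm' : ∫ y, w y • v y = P • m := by
    rw [hm, ← integral_smul]
    refine integral_congr_ae (Filter.Eventually.of_forall fun y => ?_)
    simp only [smul_smul]
    congr 1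
    field_simp
  have hin : Integrable (fun y => inner ℝ b (w y • v y)) := h1.const_inner b
  have e : ∀ y, w y * ‖b - v y‖ ^ 2
      = (w y * ‖b‖ ^ 2 - 2 * inner ℝ b (w y • v y)) + w y * ‖v y‖ ^ 2 := by
    intro y
    rw [norm_sub_sq_real, inner_smul_right]
    ring
  have hI : ∫ y, w y * ‖b - v y‖ ^ 2
      = P * ‖b‖ ^ 2 - 2 * (P * inner ℝ b m) + ∫ y, w y * ‖v y‖ ^ 2 := by
    simp_rw [e]
    have h3 : Integrable (fun y => w y * ‖b‖ ^ 2 - 2 * inner ℝ b (w y • v y)) :=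
      (hwi.mul_const _).sub (hin.const_mul 2)
    rw [integral_add h3 h2,
      integral_sub (hwi.mul_const _) (hin.const_mul 2), integral_mul_const,
      integral_const_mul, integral_inner h1, hm', inner_smul_right, ← hP]
  rw [integral_const_mul, integral_const_mul, hI, norm_sub_sq_real]
  ring

/-- The flow matching loss and the conditional flow matching loss differ
by a constant independent of `b`: `L_FM(b) = L_CFM(b) + C` with
`C = ∫∫ λ p_t ‖u_t‖² − ∫∫∫ λ p_0 p_{t0} ‖u_{t0}‖²`. -/
theorem flow_matching_loss_eq_conditional_flow_matching_loss
    (d : ℕ) (hd : 1 ≤ d)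
    (p0 : EuclideanSpace ℝ (Fin d) → ℝ)
    (pt0 : ℝ → EuclideanSpace ℝ (Fin d) → EuclideanSpace ℝ (Fin d) → ℝ)
    (hp0_nonneg : ∀ x, 0 ≤ p0 x)
    (hp0_meas : Measurable p0)
    (hp0_int : ∫ x, p0 x = 1)
    (hpt0_nonneg : ∀ t ∈ Icc (0:ℝ) 1, ∀ x0 x, 0 ≤ pt0 t x0 x)
    (hpt0_meas : ∀ t ∈ Icc (0:ℝ) 1,
      Measurable (fun q : EuclideanSpace ℝ (Fin d) × EuclideanSpace ℝ (Fin d) => pt0 t q.1 q.2))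
    (hpt0_int : ∀ t ∈ Icc (0:ℝ) 1, ∀ x0, ∫ x, pt0 t x0 x = 1)
    (pt : ℝ → EuclideanSpace ℝ (Fin d) → ℝ)
    (hpt_def : ∀ t x, pt t x = ∫ x0, pt0 t x0 x * p0 x0)
    (hpt_pos : ∀ t ∈ Icc (0:ℝ) 1, ∀ x, 0 < pt t x)
    (p0t : ℝ → EuclideanSpace ℝ (Fin d) → EuclideanSpace ℝ (Fin d) → ℝ)
    (hp0t_def : ∀ t x0 x, p0t t x0 x = pt0 t x0 x * p0 x0 / pt t x)
    -- the jointly measurable family of conditional vector fields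
    (u : ℝ → EuclideanSpace ℝ (Fin d) → EuclideanSpace ℝ (Fin d) → EuclideanSpace ℝ (Fin d))
    (hu_meas : Measurable
      (fun q : ℝ × EuclideanSpace ℝ (Fin d) × EuclideanSpace ℝ (Fin d) => u q.1 q.2.1 q.2.2))
    -- `λ` is a probability density over time
    (lam : ℝ → ℝ)
    (hlam_nonneg : ∀ t, 0 ≤ lam t)
    (hlam_int : ∫ t in Icc (0:ℝ) 1, lam t = 1)
    -- the marginal vector field `u_t`
    (ut : ℝ → EuclideanSpace ℝ (Fin d) → EuclideanSpace ℝ (Fin d))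
    (hut_def : ∀ t x, ut t x = ∫ x0, p0t t x0 x • u t x0 x)
    -- finiteness of the weighted second moments
    (hmom_ut : Integrable
      (fun q : ℝ × EuclideanSpace ℝ (Fin d) =>
        lam q.1 * pt q.1 q.2 * ‖ut q.1 q.2‖ ^ 2)
      ((volume.restrict (Icc (0:ℝ) 1)).prod volume))
    (hmom_u : Integrable
      (fun q : ℝ × EuclideanSpace ℝ (Fin d) × EuclideanSpace ℝ (Fin d) =>
        lam q.1 * p0 q.2.2 * pt0 q.1 q.2.2 q.2.1 * ‖u q.1 q.2.2 q.2.1‖ ^ 2)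
      ((volume.restrict (Icc (0:ℝ) 1)).prod (volume.prod volume))) :
    ∃ C : ℝ,
      C = (∫ t in Icc (0:ℝ) 1, ∫ x, lam t * pt t x * ‖ut t x‖ ^ 2) -
          (∫ t in Icc (0:ℝ) 1, ∫ x, ∫ x0,
            lam t * p0 x0 * pt0 t x0 x * ‖u t x0 x‖ ^ 2) ∧
      ∀ b : ℝ → EuclideanSpace ℝ (Fin d) → EuclideanSpace ℝ (Fin d),
        Integrable
          (fun q : ℝ × EuclideanSpace ℝ (Fin d) =>
            lam q.1 * pt q.1 q.2 * ‖b q.1 q.2 - ut q.1 q.2‖ ^ 2)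
          ((volume.restrict (Icc (0:ℝ) 1)).prod volume) →
        Integrable
          (fun q : ℝ × EuclideanSpace ℝ (Fin d) × EuclideanSpace ℝ (Fin d) =>
            lam q.1 * p0 q.2.2 * pt0 q.1 q.2.2 q.2.1 * ‖b q.1 q.2.1 - u q.1 q.2.2 q.2.1‖ ^ 2)
          ((volume.restrict (Icc (0:ℝ) 1)).prod (volume.prod volume)) →
        (∫ t in Icc (0:ℝ) 1, ∫ x, lam t * pt t x * ‖b t x - ut t x‖ ^ 2) =
        (∫ t in Icc (0:ℝ) 1, ∫ x, ∫ x0,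
            lam t * p0 x0 * pt0 t x0 x * ‖b t x - u t x0 x‖ ^ 2) + C := by
  refine ⟨_, rfl, fun b hb1 hb2 => ?_⟩
  refine fm_aux_integral (volume.restrict (Icc (0:ℝ) 1))
    (fun t x => lam t * pt t x * ‖b t x - ut t x‖ ^ 2)
    (fun t x => lam t * pt t x * ‖ut t x‖ ^ 2)
    (fun t x x0 => lam t * p0 x0 * pt0 t x0 x * ‖b t x - u t x0 x‖ ^ 2)
    (fun t x x0 => lam t * p0 x0 * pt0 t x0 x * ‖u t x0 x‖ ^ 2) hb1 hmom_ut hb2 hmom_u ?_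
  filter_upwards [hmom_u.prod_right_ae, ae_restrict_mem measurableSet_Icc] with t ht htI
  filter_upwards [ht.prod_right_ae] with x hx
  have r : ∀ (x0 : EuclideanSpace ℝ (Fin d)) (c : ℝ), lam t * p0 x0 * pt0 t x0 x * c
      = lam t * ((pt0 t x0 x * p0 x0) * c) := by
    intro x0 c
    ring
  simp only [r] at hx ⊢
  have hwm : Measurable (fun x0 => pt0 t x0 x * p0 x0) :=
    ((hpt0_meas t htI).comp (measurable_id.prodMk measurable_const)).mul hp0_meas
  have hvm : Measurable (fun x0 => u t x0 x) :=
    hu_meas.comp (measurable_const.prodMk (measurable_id.prodMk measurable_const))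
  refine fm_aux_pointwise (lam t) (pt t x) (hlam_nonneg t) (fun x0 => pt0 t x0 x * p0 x0)
    (fun x0 => mul_nonneg (hpt0_nonneg t htI x0 x) (hp0_nonneg x0)) hwm (hpt_def t x)
    (hpt_pos t htI x) (fun x0 => u t x0 x) hvm (ut t x) (b t x) ?_ hx
  rw [hut_def]
  simp only [hp0t_def]
end
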